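/- Let n ≥ 2, let A be an invertible n×n complex matrix, let ν be the Haar probability measure on the unitary group U(n), and let σ be the uniform (unitarily invariant) probability measure on the unit sphere of ℂⁿ. Then ∫_{U(n)} log ρ(U·A) dν(U) ≥ ∫ log ‖A·v‖ dσ(v), where ρ(B) denotes the spectral radius of B. (The left-hand side is the average over the unitarily invariant family U(n)·A of the logarithm of the modulus of the largest eigenvalue; the right-hand side is the largest random Lyapunov exponent of the family.) -/

import Mathlib

open MeasureTheory

noncomputable instance (n : ℕ) : MeasurableSpace (Matrix (Fin n) (Fin n) ℂ) := borel _
instance (n : ℕ) : BorelSpace (Matrix (Fin n) (Fin n) ℂ) := ⟨rfl⟩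
noncomputable instance (n : ℕ) : MeasurableSpace (EuclideanSpace ℂ (Fin n)) := borel _
instance (n : ℕ) : BorelSpace (EuclideanSpace ℂ (Fin n)) := ⟨rfl⟩

/-- The spectral radius of an `n×n` complex matrix: the maximum modulus of its eigenvalues. -/
noncomputable def specRadC {n : ℕ} (A : Matrix (Fin n) (Fin n) ℂ) : ℝ :=
  (spectralRadius ℂ A).toReal



section Area
variable {E : Type*} [NormedAddCommGroup E] [NormedSpace ℝ E] [FiniteDimensional ℝ E]
  [MeasurableSpace E] [BorelSpace E]

/-- Countable measurable partition of the regular set on which the map is injective. -/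
theorem ds_partition (φ : E → E) (φ' : E → E →L[ℝ] E)
    (hφ : ∀ x, HasFDerivAt φ (φ' x) x) (hC : MeasurableSet {x | (φ' x).det ≠ 0}) :
    ∃ s : ℕ → Set E, (∀ k, MeasurableSet (s k)) ∧ Pairwise (Function.onFun Disjoint s) ∧
      (⋃ k, s k) = {x | (φ' x).det ≠ 0} ∧ ∀ k, Set.InjOn φ (s k) := by
  classical
  set C : Set E := {x | (φ' x).det ≠ 0} with hCdef
  rcases C.eq_empty_or_nonempty with h0 | hne
  · refine ⟨fun _ => ∅, by simp, ?_, by simp [h0], by simp⟩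
    intro i j _; simp [Function.onFun]
  have hr : ∀ A : E →L[ℝ] E, ∃ r : NNReal, r ≠ 0 ∧ (A.det ≠ 0 → ∀ (f : E → E) (s : Set E),
      ApproximatesLinearOn f A s r → Set.InjOn f s) := by
    intro A
    by_cases hA : A.det ≠ 0
    · let B : E ≃L[ℝ] E := A.toContinuousLinearEquivOfDetNeZero hA
      have hB : (B : E →L[ℝ] E) = A := by ext; simp [B]
      by_cases hE : Subsingleton E
      · exact ⟨1, one_ne_zero, fun _ f s _ => fun x _ y _ _ => Subsingleton.elim _ _⟩
      · have : Nontrivial E := not_subsingleton_iff_nontrivial.mp hE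
        have hpos : 0 < ‖(B.symm : E →L[ℝ] E)‖₊⁻¹ := by
          rw [inv_pos]; exact B.nnnorm_symm_pos
        refine ⟨‖(B.symm : E →L[ℝ] E)‖₊⁻¹ / 2, (half_pos hpos).ne', fun _ f s h => ?_⟩
        rw [← hB] at h
        exact h.injOn (Or.inr (NNReal.half_lt_self hpos.ne'))
    · exact ⟨1, one_ne_zero, fun h => absurd h hA⟩
  choose r hr0 hr1 using hr
  obtain ⟨t, A, hdisj, hmeas, hcov, happ, hA⟩ :=
    exists_partition_approximatesLinearOn_of_hasFDerivWithinAt φ C φ'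
      (fun x _ => (hφ x).hasFDerivWithinAt) r hr0
  refine ⟨fun k => C ∩ t k, fun k => hC.inter (hmeas k), ?_, ?_, ?_⟩
  · intro i j hij
    exact (hdisj hij).mono Set.inter_subset_right Set.inter_subset_right
  · rw [← Set.inter_iUnion]; exact Set.inter_eq_left.mpr hcov
  · intro k
    obtain ⟨y, hy, hAy⟩ := hA hne k
    exact hr1 (A k) (by rw [hAy]; exact hy) φ _ (happ k)

/-- Area formula with multiplicities and weights summing to one on fibres. -/
theorem ds_area (μ : Measure E) [μ.IsAddHaarMeasure] (φ : E → E) (φ' : E → E →L[ℝ] E)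
    (hφ : ∀ x, HasFDerivAt φ (φ' x) x) (hC : MeasurableSet {x | (φ' x).det ≠ 0})
    (ω h : E → ℂ)
    (hfib : ∀ᵐ b ∂μ, ∃ R : Finset E, (∀ x, x ∈ R ↔ (φ x = b ∧ (φ' x).det ≠ 0)) ∧
      ∑ x ∈ R, ω x = 1)
    (hInteg : Integrable (fun x => |(φ' x).det| • (h (φ x) * ω x)) μ) :
    ∫ x, |(φ' x).det| • (h (φ x) * ω x) ∂μ = ∫ b, h b ∂μ := by
  classical
  obtain ⟨s, hsm, hsd, hsU, hinj⟩ := ds_partition φ φ' hφ hC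
  have hder : ∀ k, ∀ x ∈ s k, HasFDerivWithinAt φ (φ' x) (s k) x :=
    fun k x _ => (hφ x).hasFDerivWithinAt
  have himm : ∀ k, MeasurableSet (φ '' s k) := fun k =>
    measurable_image_of_fderivWithin (hsm k) (hder k) (hinj k)
  let G : ℕ → E → ℂ := fun k b => h b * ω (Function.invFunOn φ (s k) b)
  have hG : ∀ k, ∀ x ∈ s k, G k (φ x) = h (φ x) * ω x := by
    intro k x hx
    simp only [G]
    rw [(hinj k).leftInvOn_invFunOn hx]
  let F : ℕ → E → ℂ := fun k => (φ '' s k).indicator (G k)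
  have hGint : ∀ k, IntegrableOn (G k) (φ '' s k) μ := by
    intro k
    rw [integrableOn_image_iff_integrableOn_abs_det_fderiv_smul μ (hsm k) (hder k) (hinj k)]
    refine (hInteg.integrableOn (s := s k)).congr_fun (fun x hx => ?_) (hsm k)
    simp only [hG k x hx]
  have hFint : ∀ k, Integrable (F k) μ := fun k => (hGint k).integrable_indicator (himm k)
  have hFnorm : ∀ k, ∫ b, ‖F k b‖ ∂μ = ∫ x in s k, ‖|(φ' x).det| • (h (φ x) * ω x)‖ ∂μ := by
    intro k
    have : (fun b => ‖F k b‖) = (φ '' s k).indicator (fun b => ‖G k b‖) := by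
      ext b; simp only [F]; rw [norm_indicator_eq_indicator_norm]
    rw [this, integral_indicator (himm k),
      integral_image_eq_integral_abs_det_fderiv_smul μ (hsm k) (hder k) (hinj k)]
    refine setIntegral_congr_fun (hsm k) (fun x hx => ?_)
    simp only [hG k x hx, norm_smul, smul_eq_mul, Real.norm_eq_abs, abs_abs]
  have hFval : ∀ k, ∫ b, F k b ∂μ = ∫ x in s k, |(φ' x).det| • (h (φ x) * ω x) ∂μ := by
    intro k
    simp only [F]
    rw [integral_indicator (himm k),
      integral_image_eq_integral_abs_det_fderiv_smul μ (hsm k) (hder k) (hinj k)]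
    refine setIntegral_congr_fun (hsm k) (fun x hx => ?_)
    simp only [hG k x hx]
  have hsum1 := hasSum_integral_iUnion (μ := μ) hsm hsd (hInteg.norm.integrableOn (s := ⋃ k, s k))
  have hsum2 := hasSum_integral_iUnion (μ := μ) hsm hsd (hInteg.integrableOn (s := ⋃ k, s k))
  have hsumF : HasSum (fun k => ∫ b, F k b ∂μ) (∫ b, ∑' k, F k b ∂μ) := by
    refine hasSum_integral_of_summable_integral_norm hFint ?_
    simp_rw [hFnorm]
    exact hsum1.summable
  simp_rw [hFval] at hsumF
  have e1 := hsumF.unique hsum2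
  have e2 : ∫ x in ⋃ k, s k, |(φ' x).det| • (h (φ x) * ω x) ∂μ
      = ∫ x, |(φ' x).det| • (h (φ x) * ω x) ∂μ := by
    rw [hsU]
    refine setIntegral_eq_integral_of_forall_compl_eq_zero (fun x hx => ?_)
    have : (φ' x).det = 0 := by simpa using hx
    simp [this]
  rw [← e2, ← e1]
  refine integral_congr_ae ?_
  filter_upwards [hfib] with b hb
  obtain ⟨R, hR, hR1⟩ := hb
  have hFk : ∀ k, F k b = ∑ x ∈ R, (if x ∈ s k then h b * ω x else 0) := by
    intro k
    by_cases hbk : b ∈ φ '' s k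
    · obtain ⟨x, hx, rfl⟩ := hbk
      have hxR : x ∈ R := (hR x).2 ⟨rfl, by
        have : x ∈ ⋃ k, s k := Set.mem_iUnion.2 ⟨k, hx⟩
        rw [hsU] at this; exact this⟩
      rw [Finset.sum_eq_single x]
      · simp only [F]
        rw [Set.indicator_of_mem (Set.mem_image_of_mem φ hx), hG k x hx, if_pos hx]
      · intro y hy hyx
        refine if_neg (fun hys => hyx ?_)
        exact hinj k hys hx ((hR y).1 hy).1
      · intro hx'; exact absurd hxR hx'
    · simp only [F]
      rw [Set.indicator_of_notMem hbk]
      symm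
      refine Finset.sum_eq_zero (fun x hx => if_neg (fun hxs => hbk ?_))
      exact ⟨x, hxs, ((hR x).1 hx).1⟩
  have hsingle : ∀ x ∈ R, ∃ k0, x ∈ s k0 := by
    intro x hx
    have : x ∈ ⋃ k, s k := by rw [hsU]; exact ((hR x).1 hx).2
    exact Set.mem_iUnion.1 this
  have hterm : ∀ x ∈ R, HasSum (fun k => if x ∈ s k then h b * ω x else 0) (h b * ω x) := by
    intro x hx
    obtain ⟨k0, hk0⟩ := hsingle x hx
    have := hasSum_single (f := fun k => if x ∈ s k then h b * ω x else 0) k0 (fun k hk => by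
      refine if_neg (fun hxk => ?_)
      exact Set.disjoint_left.1 (hsd hk) hxk hk0)
    simpa [hk0] using this
  have := (hasSum_sum hterm).tsum_eq
  simp_rw [hFk]
  rw [this, ← Finset.mul_sum, hR1, mul_one]

/-- Bound for the area formula with multiplicity at most `N`. -/
theorem ds_area_le (μ : Measure E) [μ.IsAddHaarMeasure] (φ : E → E) (φ' : E → E →L[ℝ] E)
    (hφ : ∀ x, HasFDerivAt φ (φ' x) x) (hC : MeasurableSet {x | (φ' x).det ≠ 0})
    (h : E → ENNReal) (hh : Measurable h) (N : ℕ)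
    (hfib : ∀ᵐ b ∂μ, ∃ R : Finset E, (∀ x, x ∈ R ↔ (φ x = b ∧ (φ' x).det ≠ 0)) ∧ R.card ≤ N) :
    ∫⁻ x, ENNReal.ofReal |(φ' x).det| * h (φ x) ∂μ ≤ N * ∫⁻ b, h b ∂μ := by
  classical
  obtain ⟨s, hsm, hsd, hsU, hinj⟩ := ds_partition φ φ' hφ hC
  have hder : ∀ k, ∀ x ∈ s k, HasFDerivWithinAt φ (φ' x) (s k) x :=
    fun k x _ => (hφ x).hasFDerivWithinAt
  have himm : ∀ k, MeasurableSet (φ '' s k) := fun k =>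
    measurable_image_of_fderivWithin (hsm k) (hder k) (hinj k)
  have e2 : ∫⁻ x, ENNReal.ofReal |(φ' x).det| * h (φ x) ∂μ
      = ∫⁻ x in ⋃ k, s k, ENNReal.ofReal |(φ' x).det| * h (φ x) ∂μ := by
    rw [hsU, ← lintegral_indicator hC]
    refine lintegral_congr (fun x => ?_)
    by_cases hx : (φ' x).det = 0
    · simp [hx]
    · rw [Set.indicator_of_mem (by exact hx)]
  rw [e2, lintegral_iUnion hsm hsd]
  have : ∀ k, ∫⁻ x in s k, ENNReal.ofReal |(φ' x).det| * h (φ x) ∂μ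
      = ∫⁻ b, (φ '' s k).indicator h b ∂μ := by
    intro k
    rw [lintegral_indicator (himm k),
      lintegral_image_eq_lintegral_abs_det_fderiv_mul μ (hsm k) (hder k) (hinj k)]
  simp_rw [this]
  rw [← lintegral_tsum (fun k => (hh.indicator (himm k)).aemeasurable),
    ← lintegral_const_mul _ hh]
  refine lintegral_mono_ae ?_
  filter_upwards [hfib] with b hb
  obtain ⟨R, hR, hRN⟩ := hb
  have hle : ∀ k, (φ '' s k).indicator h b ≤ ∑ x ∈ R, (if x ∈ s k then h b else 0) := by
    intro k
    by_cases hbk : b ∈ φ '' s k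
    · rw [Set.indicator_of_mem hbk]
      obtain ⟨x, hx, rfl⟩ := hbk
      have hxR : x ∈ R := (hR x).2 ⟨rfl, by
        have : x ∈ ⋃ k, s k := Set.mem_iUnion.2 ⟨k, hx⟩
        rw [hsU] at this; exact this⟩
      refine le_trans ?_ (Finset.single_le_sum (f := fun y => if y ∈ s k then h (φ x) else 0)
        (fun _ _ => zero_le) hxR)
      simp [hx]
    · rw [Set.indicator_of_notMem hbk]; exact zero_le
  refine (ENNReal.tsum_le_tsum hle).trans ?_
  rw [Summable.tsum_finsetSum (fun _ _ => ENNReal.summable)]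
  have hone : ∀ x ∈ R, ∑' k, (if x ∈ s k then h b else 0) ≤ h b := by
    intro x hx
    have : x ∈ ⋃ k, s k := by rw [hsU]; exact ((hR x).1 hx).2
    obtain ⟨k0, hk0⟩ := Set.mem_iUnion.1 this
    rw [tsum_eq_single k0 (fun k hk => by
      refine if_neg (fun hxk => ?_)
      exact Set.disjoint_left.1 (hsd hk) hxk hk0)]
    simp [hk0]
  refine (Finset.sum_le_sum hone).trans ?_
  rw [Finset.sum_const, nsmul_eq_mul]
  gcongr
end Area

set_option linter.unusedSimpArgs false

/-- Parameters `(w, (a, Z))` of a matrix with blocks `a`, `w`, `Z`. -/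
abbrev DsT (m : ℕ) := (Fin m → ℂ) × (ℂ × (Fin m → Fin m → ℂ))

/-- The matrix with blocks `a`, `w`, `b`, `Z`. -/
def dsMat {m : ℕ} (a : DsT m) (b : Fin m → ℂ) : Matrix (Unit ⊕ Fin m) (Unit ⊕ Fin m) ℂ :=
  Matrix.fromBlocks (Matrix.of fun _ _ => a.2.1) (Matrix.of fun _ j => a.1 j)
    (Matrix.of fun i _ => b i) (Matrix.of a.2.2)

/-- The shear. -/
def dsShear {m : ℕ} (x : Fin m → ℂ) (a : DsT m) : DsT m :=
  (a.1, (a.2.1 + a.1 ⬝ᵥ x, fun i j => a.2.2 i j - x i * a.1 j))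

/-- The Riccati map. -/
def dsPhi {m : ℕ} (a : DsT m) (x : Fin m → ℂ) : Fin m → ℂ :=
  a.2.1 • x + (a.1 ⬝ᵥ x) • x - (Matrix.of a.2.2).mulVec x

/-- The lower unipotent matrix. -/
def dsN {m : ℕ} (x : Fin m → ℂ) : Matrix (Unit ⊕ Fin m) (Unit ⊕ Fin m) ℂ :=
  Matrix.fromBlocks 1 0 (Matrix.of fun i _ => x i) 1

/-- The characteristic determinant `det (lam - Y)`. -/
noncomputable def dsDet {m : ℕ} (T : DsT m) : ℂ :=
  (T.2.1 • (1 : Matrix (Fin m) (Fin m) ℂ) - Matrix.of T.2.2).det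

theorem dsMat_mul_dsN {m : ℕ} (a : DsT m) (x : Fin m → ℂ) :
    dsMat a (dsPhi a x) * dsN x = dsN x * dsMat (dsShear x a) 0 := by
  unfold dsMat dsN dsShear dsPhi
  rw [Matrix.fromBlocks_multiply, Matrix.fromBlocks_multiply]
  congr 1
  · ext i j; simp [Matrix.mul_apply, dotProduct]
  · ext i j; simp
  · ext i j; simp [Matrix.mul_apply, Matrix.mulVec, dotProduct]; ring
  · ext i j; simp [Matrix.mul_apply]

theorem dsN_mul_inv {m : ℕ} (x : Fin m → ℂ) : dsN x * dsN (-x) = 1 := by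
  unfold dsN
  rw [Matrix.fromBlocks_multiply, ← Matrix.fromBlocks_one]
  congr 1
  · simp
  · simp
  · ext i j; simp [Matrix.mul_apply, Matrix.one_apply]
  · simp

theorem dsMat_eq_conj {m : ℕ} (a : DsT m) (x : Fin m → ℂ) :
    dsMat a (dsPhi a x) = dsN x * dsMat (dsShear x a) 0 * dsN (-x) := by
  rw [← dsMat_mul_dsN, Matrix.mul_assoc, dsN_mul_inv, Matrix.mul_one]

/-- The derivative of the Riccati map. -/
noncomputable def dsPhi' {m : ℕ} (a : DsT m) (x : Fin m → ℂ) : (Fin m → ℂ) →L[ℂ] (Fin m → ℂ) :=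
  LinearMap.toContinuousLinearMap (Matrix.toLin'
    ((dsShear x a).2.1 • (1 : Matrix (Fin m) (Fin m) ℂ) - Matrix.of (dsShear x a).2.2))

theorem dsPhi_hasFDerivAt {m : ℕ} (a : DsT m) (x : Fin m → ℂ) :
    HasFDerivAt (dsPhi a) ((dsPhi' a x).restrictScalars ℝ) x := by
  refine HasFDerivAt.restrictScalars ℝ ?_
  have h1 : HasFDerivAt (fun y : Fin m → ℂ => y) (ContinuousLinearMap.id ℂ _) x := hasFDerivAt_id x
  let l : (Fin m → ℂ) →L[ℂ] ℂ := LinearMap.toContinuousLinearMap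
    (LinearMap.mk ⟨fun y => a.1 ⬝ᵥ y, fun y z => dotProduct_add _ _ _⟩
      (fun c y => by simp [dotProduct_smul]))
  have h2 : HasFDerivAt (fun y : Fin m → ℂ => a.1 ⬝ᵥ y) l x := l.hasFDerivAt
  let Zl : (Fin m → ℂ) →L[ℂ] (Fin m → ℂ) :=
    LinearMap.toContinuousLinearMap (Matrix.toLin' (Matrix.of a.2.2))
  have h3 : HasFDerivAt (fun y : Fin m → ℂ => (Matrix.of a.2.2).mulVec y) Zl x := by
    have := Zl.hasFDerivAt (x := x)
    exact this
  have h4 := ((h1.const_smul a.2.1).add (h2.smul h1)).sub h3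
  refine HasFDerivAt.congr_fderiv h4 ?_
  ext v i
  simp [dsPhi', dsShear, l, Zl, Matrix.sub_mulVec, Matrix.smul_mulVec, Matrix.mulVec, dotProduct,
    sub_mul, Finset.sum_sub_distrib, Finset.sum_add_distrib, Finset.mul_sum, Finset.sum_mul,
    mul_assoc, add_mul]
  simp [mul_comm]
  ring_nf

theorem dsPhi'_det {m : ℕ} (a : DsT m) (x : Fin m → ℂ) :
    ((dsPhi' a x).restrictScalars ℝ).det = Complex.normSq (dsDet (dsShear x a)) := by
  have : ((dsPhi' a x).restrictScalars ℝ).det = LinearMap.det (((dsPhi' a x) :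
    (Fin m → ℂ) →ₗ[ℂ] (Fin m → ℂ)).restrictScalars ℝ) := rfl
  rw [this, LinearMap.det_restrictScalars, Algebra.norm_complex_eq]
  have h2 : LinearMap.det ((dsPhi' a x) : (Fin m → ℂ) →ₗ[ℂ] (Fin m → ℂ))
      = dsDet (dsShear x a) := LinearMap.det_toLin' _
  rw [h2]
  rfl

theorem dsDet_eq_eval {m : ℕ} (T : DsT m) :
    dsDet T = (Matrix.of T.2.2).charpoly.eval T.2.1 := by
  rw [Matrix.eval_charpoly, dsDet]
  congr 1
  ext i j; simp [Matrix.scalar_apply, Matrix.diagonal_apply, Matrix.one_apply]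

theorem dsMat_charpoly {m : ℕ} (T : DsT m) :
    (dsMat T 0).charpoly =
      (Polynomial.X - Polynomial.C T.2.1) * (Matrix.of T.2.2).charpoly := by
  have : (Matrix.of fun (i : Fin m) (_ : Unit) => (0 : Fin m → ℂ) i) = 0 := by ext; simp
  unfold dsMat
  rw [this, Matrix.charpoly_fromBlocks_zero₂₁]
  congr 1
  rw [Matrix.charpoly, Matrix.det_unique]
  simp

theorem dsMat_phi_charpoly {m : ℕ} (a : DsT m) (x : Fin m → ℂ) :
    (dsMat a (dsPhi a x)).charpoly =
      (Polynomial.X - Polynomial.C (dsShear x a).2.1) *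
        (Matrix.of (dsShear x a).2.2).charpoly := by
  rw [dsMat_eq_conj, Matrix.charpoly_mul_comm, ← Matrix.mul_assoc]
  have : dsN (-x) * dsN x = 1 := by simpa using dsN_mul_inv (-x)
  rw [this, Matrix.one_mul, dsMat_charpoly]

/-- No eigenvector of `Z` is annihilated by `w`. -/
def DsGood {m : ℕ} (w : Fin m → ℂ) (Z : Fin m → Fin m → ℂ) : Prop :=
  ∀ (η : Fin m → ℂ) (μ : ℂ), w ⬝ᵥ η = 0 → (Matrix.of Z).mulVec η = μ • η → η = 0

theorem dsMat_mulVec_one {m : ℕ} (a : DsT m) (b x : Fin m → ℂ) (μ : ℂ)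
    (h : (dsMat a b).mulVec (Sum.elim (fun _ => 1) x) = μ • (Sum.elim (fun _ => 1) x)) :
    dsPhi a x = b ∧ (dsShear x a).2.1 = μ := by
  have h1 := congrFun h (Sum.inl ())
  simp [dsMat, Matrix.fromBlocks_mulVec, Matrix.mulVec, dotProduct] at h1
  have h3 : (dsShear x a).2.1 = μ := by simp [dsShear, dotProduct, h1]
  refine ⟨?_, h3⟩
  ext i
  have h2 := congrFun h (Sum.inr i)
  simp [dsMat, Matrix.fromBlocks_mulVec, Matrix.mulVec, dotProduct] at h2
  simp [dsPhi, Matrix.mulVec, dotProduct]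
  linear_combination x i * h1 - h2

theorem ds_fiber {m : ℕ} (a : DsT m) (hg : DsGood a.1 a.2.2) (b : Fin m → ℂ)
    (hb : ∀ x, dsPhi a x = b → dsDet (dsShear x a) ≠ 0) :
    ∃ R : Finset (Fin m → ℂ), (∀ x, x ∈ R ↔ dsPhi a x = b) ∧
      ∑ x ∈ R, (dsShear x a).2.1 ^ m / dsDet (dsShear x a) = 1 ∧ R.card ≤ m + 1 := by
  classical
  set M := dsMat a b with hM
  set χ := M.charpoly with hχ
  have hχmonic : χ.Monic := M.charpoly_monic
  have hdeg : χ.natDegree = m + 1 := by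
    rw [hχ, Matrix.charpoly_natDegree_eq_dim]; simp [add_comm]
  -- existence
  have hex : ∀ μ ∈ χ.roots.toFinset, ∃ x, dsPhi a x = b ∧ (dsShear x a).2.1 = μ := by
    intro μ hμ
    have hroot : χ.IsRoot μ := by
      rw [Multiset.mem_toFinset] at hμ; exact (Polynomial.mem_roots'.1 hμ).2
    rw [← Matrix.mem_spectrum_iff_isRoot_charpoly, ← Matrix.spectrum_toLin',
      ← Module.End.hasEigenvalue_iff_mem_spectrum] at hroot
    obtain ⟨ξ, hξ⟩ := hroot.exists_hasEigenvector
    have hξ1 : M.mulVec ξ = μ • ξ := by simpa using hξ.apply_eq_smul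
    have hξ0 : ξ ≠ 0 := hξ.2
    have hne : ξ (Sum.inl ()) ≠ 0 := by
      intro h0
      apply hξ0
      have hz : (fun i => ξ (Sum.inr i)) = 0 := by
        refine hg _ μ ?_ ?_
        · have := congrFun hξ1 (Sum.inl ())
          simpa [hM, dsMat, Matrix.fromBlocks_mulVec, Matrix.mulVec, dotProduct, h0] using this
        · ext i
          have := congrFun hξ1 (Sum.inr i)
          simpa [hM, dsMat, Matrix.fromBlocks_mulVec, Matrix.mulVec, dotProduct, h0] using this
      ext i
      rcases i with ⟨⟩ | i
      · exact h0
      · exact congrFun hz i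
    refine ⟨fun i => (ξ (Sum.inl ()))⁻¹ * ξ (Sum.inr i), ?_⟩
    apply dsMat_mulVec_one
    have : (Sum.elim (fun _ => 1) (fun i => (ξ (Sum.inl ()))⁻¹ * ξ (Sum.inr i)) : Unit ⊕ Fin m → ℂ)
        = (ξ (Sum.inl ()))⁻¹ • ξ := by
      ext i; rcases i with ⟨⟩ | i <;> simp [hne]
    rw [this, Matrix.mulVec_smul, hξ1, smul_comm]
  choose! xf hxf1 hxf2 using hex
  have hcp : ∀ x, dsPhi a x = b → χ = (Polynomial.X - Polynomial.C (dsShear x a).2.1) *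
        (Matrix.of (dsShear x a).2.2).charpoly := by
    intro x hx
    rw [hχ, hM, ← hx, dsMat_phi_charpoly]
  have hmem : ∀ x, dsPhi a x = b → (dsShear x a).2.1 ∈ χ.roots.toFinset := by
    intro x hx
    rw [Multiset.mem_toFinset, Polynomial.mem_roots hχmonic.ne_zero, hcp x hx]
    simp
  have hinj : ∀ x y, dsPhi a x = b → dsPhi a y = b → (dsShear x a).2.1 = (dsShear y a).2.1 →
      x = y := by
    intro x y hx hy hxy
    rw [← sub_eq_zero]
    simp only [dsShear, add_right_inj] at hxy
    refine hg _ (dsShear x a).2.1 (by rw [dotProduct_sub, hxy, sub_self]) ?_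
    rw [← hy] at hx
    simp only [dsPhi] at hx
    rw [Matrix.mulVec_sub]
    simp only [dsShear]
    ext i
    have := congrFun hx i
    simp at this ⊢
    rw [← hxy] at this
    linear_combination -this
  have hder : ∀ x, dsPhi a x = b →
      χ.derivative.eval (dsShear x a).2.1 = dsDet (dsShear x a) := by
    intro x hx
    rw [hcp x hx, dsDet_eq_eval]
    simp [Polynomial.derivative_mul]
  have hnodup : χ.roots.Nodup := by
    rw [Multiset.nodup_iff_count_le_one]
    intro μ
    by_contra hcon
    push Not at hcon
    rw [Polynomial.count_roots, Polynomial.one_lt_rootMultiplicity_iff_isRoot hχmonic.ne_zero] at hcon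
    have hμ : μ ∈ χ.roots.toFinset := by
      rw [Multiset.mem_toFinset, Polynomial.mem_roots hχmonic.ne_zero]; exact hcon.1
    apply hb (xf μ) (hxf1 μ hμ)
    rw [← hder _ (hxf1 μ hμ), hxf2 μ hμ]
    exact hcon.2
  have hcard : χ.roots.toFinset.card = m + 1 := by
    rw [Multiset.toFinset_card_of_nodup hnodup, ← hdeg]
    exact (IsAlgClosed.splits χ).natDegree_eq_card_roots.symm
  have hprod : χ = Lagrange.nodal χ.roots.toFinset id := by
    have := (IsAlgClosed.splits χ).eq_prod_roots_of_monic hχmonic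
    rw [Lagrange.nodal]
    conv_lhs => rw [this]
    rw [Finset.prod_eq_multiset_prod, Multiset.toFinset_val, hnodup.dedup]
    rfl
  have hinjR : Set.InjOn xf χ.roots.toFinset := by
    intro μ hμ μ' hμ' h
    rw [← hxf2 μ hμ, ← hxf2 μ' hμ', h]
  refine ⟨χ.roots.toFinset.image xf, ?_, ?_, ?_⟩
  · intro x
    rw [Finset.mem_image]
    constructor
    · rintro ⟨μ, hμ, rfl⟩; exact hxf1 μ hμ
    · intro hx
      exact ⟨_, hmem x hx, hinj _ _ (hxf1 _ (hmem x hx)) hx (hxf2 _ (hmem x hx))⟩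
  · rw [Finset.sum_image hinjR]
    have hL := Lagrange.coeff_eq_sum (s := χ.roots.toFinset) (v := id) (F := ℂ)
      (Function.injective_id.injOn) (P := Polynomial.X ^ m) (by
        rw [Polynomial.degree_X_pow, hcard]; exact_mod_cast Nat.lt_succ_self m)
    rw [hcard] at hL
    simp at hL
    rw [hL]
    refine Finset.sum_congr rfl (fun μ hμ => ?_)
    rw [← hder _ (hxf1 μ hμ), hxf2 μ hμ]
    congr 1
    have := Lagrange.eval_nodal_derivative_eval_node_eq (v := (id : ℂ → ℂ)) hμ
    rw [← hprod, Lagrange.nodal, Polynomial.eval_prod] at this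
    simpa using this
  · rw [Finset.card_image_of_injOn hinjR, hcard]

instance dsHaar0 (m : ℕ) : (volume : Measure (Fin m → ℂ)).IsAddHaarMeasure := inferInstance

instance dsHaar1 (m : ℕ) : (volume : Measure (Fin m → Fin m → ℂ)).IsAddHaarMeasure :=
  @Measure.pi.isAddHaarMeasure (Fin m) (fun _ => Fin m → ℂ) _ _ (fun _ => volume) _ _ _
    (fun _ => inferInstance) _

instance dsSig1 (m : ℕ) : SigmaFinite (volume : Measure (Fin m → Fin m → ℂ)) := inferInstance

instance dsHaar2 (m : ℕ) : (volume : Measure (ℂ × (Fin m → Fin m → ℂ))).IsAddHaarMeasure :=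
  Measure.prod.instIsAddHaarMeasure (volume : Measure ℂ) (volume : Measure (Fin m → Fin m → ℂ))

instance dsSig2 (m : ℕ) : SigmaFinite (volume : Measure (ℂ × (Fin m → Fin m → ℂ))) :=
  inferInstance

instance dsHaar3 (m : ℕ) :
    (volume : Measure ((Fin m → ℂ) × (Fin m → Fin m → ℂ))).IsAddHaarMeasure :=
  Measure.prod.instIsAddHaarMeasure (volume : Measure (Fin m → ℂ))
    (volume : Measure (Fin m → Fin m → ℂ))

instance dsHaar4 (m : ℕ) : (volume : Measure (DsT m)).IsAddHaarMeasure :=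
  Measure.prod.instIsAddHaarMeasure (volume : Measure (Fin m → ℂ))
    (volume : Measure (ℂ × (Fin m → Fin m → ℂ)))

instance dsSig4 (m : ℕ) : SigmaFinite (volume : Measure (DsT m)) :=
  inferInstance

instance dsHaar5 (m : ℕ) : (volume : Measure (DsT m × (Fin m → ℂ))).IsAddHaarMeasure :=
  Measure.prod.instIsAddHaarMeasure (volume : Measure (DsT m)) (volume : Measure (Fin m → ℂ))

/-- The Kalman matrix. -/
def dsK {R : Type*} [CommRing R] {m : ℕ} (w : Fin m → R) (Z : Matrix (Fin m) (Fin m) R) :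
    Matrix (Fin m) (Fin m) R :=
  Matrix.of fun k => Matrix.vecMul w (Z ^ (k : ℕ))

theorem dsK_map {R S : Type*} [CommRing R] [CommRing S] (f : R →+* S) {m : ℕ}
    (w : Fin m → R) (Z : Matrix (Fin m) (Fin m) R) :
    (dsK w Z).map f = dsK (f ∘ w) (Z.map f) := by
  ext i j
  simp only [dsK, Matrix.map_apply, Matrix.of_apply]
  rw [RingHom.map_vecMul]
  have := map_pow (RingHom.mapMatrix (m := Fin m) f) Z (i : ℕ)
  simp only [RingHom.mapMatrix_apply] at this
  rw [this]

theorem dsK_good {m : ℕ} (w : Fin m → ℂ) (Z : Fin m → Fin m → ℂ)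
    (h : (dsK w (Matrix.of Z)).det ≠ 0) : DsGood w Z := by
  intro η μ h1 h2
  refine Matrix.eq_zero_of_mulVec_eq_zero h ?_
  ext k
  have h3 : ∀ k : ℕ, ((Matrix.of Z) ^ k).mulVec η = μ ^ k • η := by
    intro k
    induction k with
    | zero => simp
    | succ k ih => rw [pow_succ, ← Matrix.mulVec_mulVec, h2, Matrix.mulVec_smul, ih, smul_smul,
        pow_succ, mul_comm]
  change (Matrix.vecMul w ((Matrix.of Z) ^ (k : ℕ))) ⬝ᵥ η = 0
  rw [← Matrix.dotProduct_mulVec, h3, dotProduct_smul, h1, smul_zero]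

theorem dsK_smul {m : ℕ} (t : ℂ) (w : Fin m → ℂ) (Z : Matrix (Fin m) (Fin m) ℂ) :
    (dsK (t • w) (t • Z)).det = (∏ k : Fin m, t ^ ((k : ℕ) + 1)) * (dsK w Z).det := by
  rw [← Matrix.det_mul_column]
  congr 1
  ext i j
  simp only [dsK, Matrix.of_apply, smul_pow, Matrix.vecMul_smul, Matrix.smul_vecMul, Pi.smul_apply,
    smul_eq_mul]
  ring

theorem dsK_shift (m : ℕ) : dsK (fun j : Fin m => if (j : ℕ) = 0 then (1 : ℂ) else 0)
    (Matrix.of fun i j : Fin m => if (j : ℕ) = (i : ℕ) + 1 then (1 : ℂ) else 0) = 1 := by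
  have h : ∀ k : ℕ, k < m → Matrix.vecMul (fun j : Fin m => if (j : ℕ) = 0 then (1 : ℂ) else 0)
    ((Matrix.of fun i j : Fin m => if (j : ℕ) = (i : ℕ) + 1 then (1 : ℂ) else 0) ^ k)
      = fun j : Fin m => if (j : ℕ) = k then (1 : ℂ) else 0 := by
    intro k
    induction k with
    | zero => intro _; simp
    | succ k ih =>
      intro hk
      rw [pow_succ, ← Matrix.vecMul_vecMul, ih (by omega)]
      ext j
      simp only [Matrix.vecMul, dotProduct, Matrix.of_apply]
      rw [Finset.sum_eq_single ⟨k, by omega⟩]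
      · simp
      · intro b _ hb
        have : (b : ℕ) ≠ k := fun h => hb (Fin.ext h)
        simp [this]
      · simp
  ext i j
  simp only [dsK, Matrix.of_apply, h i i.2, Matrix.one_apply]
  by_cases hij : i = j
  · simp [hij]
  · rw [if_neg hij, if_neg (fun h => hij (Fin.ext h.symm))]

theorem dsK_cont (m : ℕ) : Continuous (fun p : (Fin m → ℂ) × (Fin m → Fin m → ℂ) =>
    (dsK p.1 (Matrix.of p.2)).det) := by
    refine Continuous.matrix_det ?_
    refine continuous_pi (fun k => ?_)
    change Continuous (fun p : (Fin m → ℂ) × (Fin m → Fin m → ℂ) =>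
      Matrix.vecMul p.1 ((Matrix.of p.2) ^ (k : ℕ)))
    refine Continuous.matrix_vecMul continuous_fst ?_
    refine Continuous.pow ?_ _
    exact continuous_snd

theorem ds_good_ae (m : ℕ) : ∀ᵐ p : (Fin m → ℂ) × (Fin m → Fin m → ℂ),
    (dsK p.1 (Matrix.of p.2)).det ≠ 0 := by
  let w0 : Fin m → ℂ := fun j => if (j : ℕ) = 0 then (1 : ℂ) else 0
  let Z0 : Fin m → Fin m → ℂ := fun i j => if (j : ℕ) = (i : ℕ) + 1 then (1 : ℂ) else 0
  have hcont := dsK_cont m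
  have hs : MeasurableSet {p : (Fin m → ℂ) × (Fin m → Fin m → ℂ) |
      (dsK p.1 (Matrix.of p.2)).det ≠ 0} :=
    (isOpen_ne_fun hcont continuous_const).measurableSet
  have key := ae_mem_of_ae_add_linearMap_mem (LinearMap.toSpanSingleton ℂ _ (w0, Z0))
    (volume : Measure ℂ) (volume : Measure ((Fin m → ℂ) × (Fin m → Fin m → ℂ))) hs ?_
  · filter_upwards [key] with p hp
    exact hp
  intro y
  -- polynomial
  let q : Polynomial ℂ := (dsK (fun j => Polynomial.X * Polynomial.C (y.1 j) + Polynomial.C (w0 j))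
    (Matrix.of fun i j => Polynomial.X * Polynomial.C (y.2 i j) + Polynomial.C (Z0 i j))).det
  have hq : ∀ s, q.eval s = (dsK (s • y.1 + w0) (s • Matrix.of y.2 + Matrix.of Z0)).det := by
    intro s
    have := RingHom.map_det (Polynomial.evalRingHom s) (dsK (fun j => Polynomial.X * Polynomial.C (y.1 j) + Polynomial.C (w0 j))
      (Matrix.of fun i j => Polynomial.X * Polynomial.C (y.2 i j) + Polynomial.C (Z0 i j)))
    simp only [RingHom.mapMatrix_apply, dsK_map] at this
    simp only [q]
    rw [← Polynomial.coe_evalRingHom, this]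
    congr 2
    · ext j; simp; ring
    · ext i j; simp; ring
  have hq0 : q ≠ 0 := by
    intro h
    have h1 := hq 0
    rw [h] at h1
    have h2 : dsK w0 (Matrix.of Z0) = 1 := dsK_shift m
    simp [h2] at h1
  have hfin : Set.Finite {t : ℂ | t = 0 ∨ q.eval t⁻¹ = 0} := by
    refine (Set.finite_singleton (0 : ℂ)).union ?_
    have h1 : Set.Finite {s : ℂ | q.IsRoot s} := Polynomial.finite_setOfPred_isRoot hq0
    exact Set.Finite.preimage (f := fun t : ℂ => t⁻¹) (inv_injective.injOn) h1
  have h0 := hfin.measure_zero (volume : Measure ℂ)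
  rw [measure_eq_zero_iff_ae_notMem] at h0
  filter_upwards [h0] with t ht
  simp only [Set.mem_ofPred_eq, not_or] at ht
  obtain ⟨ht0, ht1⟩ := ht
  simp only [Set.mem_ofPred_eq, LinearMap.toSpanSingleton_apply, Prod.fst_add, Prod.snd_add,
    Prod.smul_mk]
  have e1 : y.1 + t • w0 = t • (t⁻¹ • y.1 + w0) := by
    rw [smul_add, smul_smul, mul_inv_cancel₀ ht0, one_smul]
  have e2 : Matrix.of (y.2 + t • Z0) = t • (t⁻¹ • Matrix.of y.2 + Matrix.of Z0) := by
    rw [smul_add, smul_smul, mul_inv_cancel₀ ht0, one_smul]; rfl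
  rw [e1, e2, dsK_smul, ← hq]
  refine mul_ne_zero ?_ ht1
  exact Finset.prod_ne_zero_iff.2 (fun k _ => pow_ne_zero _ ht0)

theorem ds_good_ae' (m : ℕ) : ∀ᵐ a : DsT m, DsGood a.1 a.2.2 := by
  have h := ds_good_ae m
  have h1 := Measure.ae_ae_of_ae_prod (μ := (volume : Measure (Fin m → ℂ)))
    (ν := (volume : Measure (Fin m → Fin m → ℂ))) h
  have hm : MeasurableSet {a : DsT m | (dsK a.1 (Matrix.of a.2.2)).det ≠ 0} := by
    have hc : Continuous (fun a : DsT m => (a.1, a.2.2)) := by fun_prop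
    exact (isOpen_ne_fun ((dsK_cont m).comp hc) continuous_const).measurableSet
  suffices ∀ᵐ a : DsT m, (dsK a.1 (Matrix.of a.2.2)).det ≠ 0 by
    filter_upwards [this] with a ha using dsK_good _ _ ha
  refine (Measure.ae_prod_iff_ae_ae (μ := (volume : Measure (Fin m → ℂ)))
    (ν := (volume : Measure (ℂ × (Fin m → Fin m → ℂ)))) hm).2 ?_
  filter_upwards [h1] with w hw
  exact (Measure.quasiMeasurePreserving_snd (μ := (volume : Measure ℂ))
    (ν := (volume : Measure (Fin m → Fin m → ℂ)))).ae hw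

theorem dsShear_mp {m : ℕ} (x : Fin m → ℂ) :
    MeasurePreserving (dsShear x : DsT m → DsT m) volume volume := by
  have hm : Measurable (Function.uncurry fun (w : Fin m → ℂ) (p : ℂ × (Fin m → Fin m → ℂ)) =>
      (p.1 + w ⬝ᵥ x, fun i j => p.2 i j - x i * w j)) := by
    refine Continuous.measurable ?_
    simp only [Function.uncurry, dotProduct]
    fun_prop
  refine MeasurePreserving.skew_product (MeasurePreserving.id volume) hm ?_
  refine Filter.Eventually.of_forall (fun w => ?_)
  have := (measurePreserving_add_right (volume : Measure (ℂ × (Fin m → Fin m → ℂ)))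
    (w ⬝ᵥ x, fun i j => - (x i * w j))).map_eq
  rw [← this]
  congr 1

section Sr
variable {κ : Type*} [Fintype κ] [DecidableEq κ]

/-- Spectral radius as a real number. -/
noncomputable def dsSr (M : Matrix κ κ ℂ) : ℝ := (spectralRadius ℂ M).toReal

section
open scoped Matrix.Norms.L2Operator

/-- Gelfand approximants of the spectral radius. -/
noncomputable def dsNk (k : ℕ) (M : Matrix κ κ ℂ) : ℝ := ‖M ^ (k + 1)‖ ^ (1 / ((k : ℝ) + 1))

/-- The operator norm. -/
noncomputable def dsNorm (M : Matrix κ κ ℂ) : ℝ := ‖M‖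

theorem dsNk_cont (k : ℕ) : Continuous (dsNk k : Matrix κ κ ℂ → ℝ) := by
  unfold dsNk
  refine Continuous.rpow_const ?_ (fun _ => Or.inr (by positivity))
  exact (continuous_id.pow (k + 1)).norm

theorem dsNorm_cont : Continuous (dsNorm : Matrix κ κ ℂ → ℝ) := continuous_norm

theorem dsNorm_unitary_mul (U M : Matrix κ κ ℂ) (hU : star U * U = 1) :
    dsNorm (U * M) = dsNorm M := by
  have : U ∈ unitary (Matrix κ κ ℂ) := ⟨hU, mul_eq_one_comm.1 hU⟩
  exact CStarRing.norm_mem_unitary_mul M this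

theorem dsNk_nonneg (k : ℕ) (M : Matrix κ κ ℂ) : 0 ≤ dsNk k M := by unfold dsNk; positivity

theorem dsNk_le (k : ℕ) (M : Matrix κ κ ℂ) : dsNk k M ≤ dsNorm M := by
  unfold dsNk dsNorm
  have h : ‖M ^ (k + 1)‖ ≤ ‖M‖ ^ (k + 1) := norm_pow_le' M (Nat.succ_pos k)
  calc ‖M ^ (k + 1)‖ ^ (1 / ((k : ℝ) + 1)) ≤ (‖M‖ ^ (k + 1)) ^ (1 / ((k : ℝ) + 1)) := by gcongr
    _ = ‖M‖ := by
      rw [← Real.rpow_natCast, ← Real.rpow_mul (norm_nonneg _)]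
      push_cast
      rw [mul_one_div_cancel (by positivity), Real.rpow_one]

theorem ds_specRad_ne_top (M : Matrix κ κ ℂ) : spectralRadius ℂ M ≠ ⊤ := by
  have h := spectrum.spectralRadius_le_pow_nnnorm_pow_one_div ℂ M 0
  refine ne_top_of_le_ne_top ?_ h
  simp [ENNReal.mul_ne_top]

theorem dsSr_le_Nk [Nonempty κ] (k : ℕ) (M : Matrix κ κ ℂ) : dsSr M ≤ dsNk k M := by
  have h := spectrum.spectralRadius_le_pow_nnnorm_pow_one_div ℂ M k
  simp only [nnnorm_one, ENNReal.coe_one, ENNReal.one_rpow, mul_one] at h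
  have h2 := ENNReal.toReal_mono (by
    refine (ENNReal.rpow_lt_top_of_nonneg (by positivity) ENNReal.coe_ne_top).ne) h
  rw [← ENNReal.toReal_rpow] at h2
  simpa [dsSr, dsNk] using h2

theorem dsNk_tendsto (M : Matrix κ κ ℂ) :
    Filter.Tendsto (fun k => dsNk k M) Filter.atTop (nhds (dsSr M)) := by
  have h := spectrum.pow_nnnorm_pow_one_div_tendsto_nhds_spectralRadius M
  have h2 := (ENNReal.tendsto_toReal (ds_specRad_ne_top M)).comp h
  have h3 := h2.comp (Filter.tendsto_add_atTop_nat 1)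
  refine h3.congr (fun k => ?_)
  simp [dsNk, ← ENNReal.toReal_rpow]

theorem dsSr_le_norm [Nonempty κ] (M : Matrix κ κ ℂ) : dsSr M ≤ dsNorm M :=
  (dsSr_le_Nk 0 M).trans (dsNk_le 0 M)

end

theorem dsSr_nonneg (M : Matrix κ κ ℂ) : 0 ≤ dsSr M := ENNReal.toReal_nonneg

theorem dsSr_ge (M : Matrix κ κ ℂ) (z : ℂ) (h : M.charpoly.IsRoot z) : ‖z‖ ≤ dsSr M := by
  rw [← Matrix.mem_spectrum_iff_isRoot_charpoly] at h
  have h1 : (‖z‖₊ : ENNReal) ≤ spectralRadius ℂ M :=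
    le_iSup₂ (f := fun (k : ℂ) (_ : k ∈ spectrum ℂ M) => (‖k‖₊ : ENNReal)) z h
  have := ENNReal.toReal_mono (ds_specRad_ne_top M) h1
  simpa [dsSr] using this

theorem dsSr_congr {κ' : Type*} [Fintype κ'] [DecidableEq κ'] (M : Matrix κ κ ℂ)
    (M' : Matrix κ' κ' ℂ)
    (h1 : ∀ z, M.charpoly.IsRoot z → ∃ z', M'.charpoly.IsRoot z' ∧ ‖z'‖ = ‖z‖)
    (h2 : ∀ z, M'.charpoly.IsRoot z → ∃ z', M.charpoly.IsRoot z' ∧ ‖z'‖ = ‖z‖) :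
    dsSr M = dsSr M' := by
  unfold dsSr
  congr 1
  refine le_antisymm ?_ ?_
  · refine iSup₂_le (fun z hz => ?_)
    obtain ⟨z', hz', e⟩ := h1 z (Matrix.mem_spectrum_iff_isRoot_charpoly.1 hz)
    have e' : ‖z‖₊ = ‖z'‖₊ := NNReal.eq e.symm
    rw [e']
    exact le_iSup₂ (f := fun (k : ℂ) (_ : k ∈ spectrum ℂ M') => (‖k‖₊ : ENNReal)) z'
      (Matrix.mem_spectrum_iff_isRoot_charpoly.2 hz')
  · refine iSup₂_le (fun z hz => ?_)
    obtain ⟨z', hz', e⟩ := h2 z (Matrix.mem_spectrum_iff_isRoot_charpoly.1 hz)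
    have e' : ‖z‖₊ = ‖z'‖₊ := NNReal.eq e.symm
    rw [e']
    exact le_iSup₂ (f := fun (k : ℂ) (_ : k ∈ spectrum ℂ M) => (‖k‖₊ : ENNReal)) z'
      (Matrix.mem_spectrum_iff_isRoot_charpoly.2 hz')

theorem dsSr_charpoly {κ' : Type*} [Fintype κ'] [DecidableEq κ'] (M : Matrix κ κ ℂ)
    (M' : Matrix κ' κ' ℂ) (h : M.charpoly = M'.charpoly) : dsSr M = dsSr M' :=
  dsSr_congr M M' (fun z hz => ⟨z, h ▸ hz, rfl⟩) (fun z hz => ⟨z, h ▸ hz, rfl⟩)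

theorem ds_root_smul (Y : Matrix κ κ ℂ) (ζ : ℂ) (hζ : ‖ζ‖ = 1) (z : ℂ)
    (h : Y.charpoly.IsRoot z) : (ζ • Y).charpoly.IsRoot (ζ * z) := by
  have h0 : ζ ≠ 0 := by rintro rfl; simp at hζ
  rw [← Matrix.mem_spectrum_iff_isRoot_charpoly] at h ⊢
  have := spectrum.unit_smul_eq_smul Y (Units.mk0 ζ h0)
  have h3 : (Units.mk0 ζ h0) • Y = ζ • Y := rfl
  rw [h3] at this
  rw [this]
  exact Set.smul_mem_smul_set h

end Sr

theorem dsMat_root {m : ℕ} (T : DsT m) (z : ℂ) : (dsMat T 0).charpoly.IsRoot z ↔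
    z = T.2.1 ∨ (Matrix.of T.2.2).charpoly.IsRoot z := by
  rw [dsMat_charpoly, Polynomial.root_mul, Polynomial.root_X_sub_C, eq_comm]

theorem dsSr_phase {m : ℕ} (w : Fin m → ℂ) (l : ℂ) (Z : Fin m → Fin m → ℂ) (ζ : ℂ)
    (hζ : ‖ζ‖ = 1) : dsSr (dsMat (w, (l, ζ • Z)) 0) = dsSr (dsMat (w, (l, Z)) 0) := by
  have h0 : ζ ≠ 0 := by rintro rfl; simp at hζ
  refine dsSr_congr _ _ ?_ ?_
  · intro z hz
    rw [dsMat_root] at hz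
    rcases hz with hz | hz
    · exact ⟨z, (dsMat_root _ _).2 (Or.inl hz), rfl⟩
    · refine ⟨ζ⁻¹ * z, (dsMat_root _ _).2 (Or.inr ?_), by simp [hζ]⟩
      have := ds_root_smul _ ζ⁻¹ (by simp [hζ]) z hz
      have e : ζ⁻¹ • (Matrix.of (ζ • Z)) = Matrix.of Z := by
        ext i j; simp [h0]
      rwa [e] at this
  · intro z hz
    rw [dsMat_root] at hz
    rcases hz with hz | hz
    · exact ⟨z, (dsMat_root _ _).2 (Or.inl hz), rfl⟩
    · exact ⟨ζ * z, (dsMat_root _ _).2 (Or.inr (ds_root_smul _ ζ hζ z hz)), by simp [hζ]⟩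

theorem dsSr_ge_lam {m : ℕ} (T : DsT m) : ‖T.2.1‖ ≤ dsSr (dsMat T 0) :=
  dsSr_ge _ _ ((dsMat_root _ _).2 (Or.inl rfl))

/-- All parameters. -/
abbrev DsE (m : ℕ) := DsT m × (Fin m → ℂ)

/-- Parametrization of matrices. -/
def dsEquiv (m : ℕ) : DsE m ≃ₗ[ℂ] Matrix (Unit ⊕ Fin m) (Unit ⊕ Fin m) ℂ where
  toFun p := dsMat p.1 p.2
  invFun M := ((fun j => M (Sum.inl ()) (Sum.inr j), (M (Sum.inl ()) (Sum.inl ()),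
    fun i j => M (Sum.inr i) (Sum.inr j))), fun i => M (Sum.inr i) (Sum.inl ()))
  map_add' p q := by
    ext i j; rcases i with i | i <;> rcases j with j | j <;> simp [dsMat]
  map_smul' c p := by
    ext i j; rcases i with i | i <;> rcases j with j | j <;> simp [dsMat]
  left_inv p := by
    simp [dsMat]
  right_inv M := by
    ext i j; rcases i with i | i <;> rcases j with j | j <;> simp [dsMat]

theorem dsEquiv_apply {m : ℕ} (p : DsE m) : dsEquiv m p = dsMat p.1 p.2 := rfl

theorem dsEquiv_cont (m : ℕ) : Continuous (dsEquiv m) :=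
  LinearMap.continuous_of_finiteDimensional (dsEquiv m).toLinearMap

theorem dsMat_cont (m : ℕ) : Continuous (fun p : DsE m => dsMat p.1 p.2) := dsEquiv_cont m

theorem dsMat0_cont (m : ℕ) : Continuous (fun T : DsT m => dsMat T 0) :=
  (dsMat_cont m).comp (by fun_prop : Continuous fun T : DsT m => (T, (0 : Fin m → ℂ)))

/-- Open bounded bi-unitarily invariant sets. -/
structure DsSet {m : ℕ} (S : Set (Matrix (Unit ⊕ Fin m) (Unit ⊕ Fin m) ℂ)) : Prop where
  isOpen : IsOpen S
  nonempty : S.Nonempty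
  bdd : ∃ C : ℝ, ∀ M ∈ S, ∀ i j, ‖M i j‖ ≤ C
  left : ∀ U M, star U * U = 1 → M ∈ S → U * M ∈ S
  right : ∀ U M, star U * U = 1 → M ∈ S → M * U ∈ S

theorem DsSet.left_iff {m : ℕ} {S : Set (Matrix (Unit ⊕ Fin m) (Unit ⊕ Fin m) ℂ)} (hS : DsSet S)
    (U M) (hU : star U * U = 1) : U * M ∈ S ↔ M ∈ S := by
  refine ⟨fun h => ?_, hS.left U M hU⟩
  have h2 := hS.left (star U) _ (by rw [star_star]; exact mul_eq_one_comm.1 hU) h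
  rwa [← mul_assoc, hU, one_mul] at h2

theorem DsSet.right_iff {m : ℕ} {S : Set (Matrix (Unit ⊕ Fin m) (Unit ⊕ Fin m) ℂ)} (hS : DsSet S)
    (U M) (hU : star U * U = 1) : M * U ∈ S ↔ M ∈ S := by
  refine ⟨fun h => ?_, hS.right U M hU⟩
  have h2 := hS.right (star U) _ (by rw [star_star]; exact mul_eq_one_comm.1 hU) h
  rwa [mul_assoc, mul_eq_one_comm.1 hU, mul_one] at h2

theorem ds_exists_unitary {κ : Type*} [Fintype κ] [DecidableEq κ] (i0 : κ) (v : κ → ℂ)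
    (hv : ∑ i, ‖v i‖ ^ 2 = 1) : ∃ V : Matrix κ κ ℂ, star V * V = 1 ∧ ∀ i, V i i0 = v i := by
  have hort : Orthonormal ℂ (Set.domRestrict ({i0} : Set κ)
      (fun _ => (WithLp.toLp 2 v : EuclideanSpace ℂ κ))) := by
    rw [orthonormal_iff_ite]
    rintro ⟨i, hi⟩ ⟨j, hj⟩
    obtain rfl : i = i0 := hi
    obtain rfl : j = i := hj
    simp only [if_true]
    rw [inner_self_eq_norm_sq_to_K, EuclideanSpace.norm_eq]
    have : ∑ i, ‖(WithLp.toLp 2 v : EuclideanSpace ℂ κ) i‖ ^ 2 = 1 := hv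
    change ((Real.sqrt (∑ i, ‖(WithLp.toLp 2 v : EuclideanSpace ℂ κ) i‖ ^ 2) : ℝ) : ℂ) ^ 2 = 1
    rw [this]
    simp
  obtain ⟨b, hb⟩ := hort.exists_orthonormalBasis_extension_of_card_eq (by simp)
  refine ⟨Matrix.of fun i j => b j i, ?_, ?_⟩
  · ext j k
    have := (orthonormal_iff_ite.1 b.orthonormal) j k
    rw [Matrix.mul_apply, Matrix.one_apply, ← this]
    simp [PiLp.inner_apply, Matrix.star_apply, mul_comm]
  · intro i
    have := hb i0 rfl
    simp [this]

theorem ds_exists_unitary_col {κ : Type*} [Fintype κ] [DecidableEq κ] (i0 : κ) (v : κ → ℂ) :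
    ∃ V : Matrix κ κ ℂ, star V * V = 1 ∧
      V.mulVec v = fun i => if i = i0 then ((Real.sqrt (∑ i, ‖v i‖ ^ 2) : ℝ) : ℂ) else 0 := by
  set r := Real.sqrt (∑ i, ‖v i‖ ^ 2) with hr
  by_cases h0 : ∑ i, ‖v i‖ ^ 2 = 0
  · have hv : v = 0 := by
      ext i
      have := (Finset.sum_eq_zero_iff_of_nonneg (fun i _ => by positivity)).1 h0 i (Finset.mem_univ i)
      simpa using this
    refine ⟨1, by simp, ?_⟩
    have : r = 0 := by rw [hr, h0, Real.sqrt_zero]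
    rw [this]
    ext i; simp [hv]
  have hpos : 0 < ∑ i, ‖v i‖ ^ 2 := lt_of_le_of_ne (by positivity) (Ne.symm h0)
  have hrpos : 0 < r := Real.sqrt_pos.2 hpos
  have hr2 : r ^ 2 = ∑ i, ‖v i‖ ^ 2 := Real.sq_sqrt hpos.le
  obtain ⟨V, hV, hV1⟩ := ds_exists_unitary i0 (fun i => (r : ℂ)⁻¹ * v i) (by
    simp only [norm_mul, mul_pow, ← Finset.mul_sum, ← hr2]
    simp [abs_of_pos hrpos]
    field_simp)
  refine ⟨star V, by rw [star_star]; exact mul_eq_one_comm.1 hV, ?_⟩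
  have e : v = V.mulVec (fun i => if i = i0 then (r : ℂ) else 0) := by
    ext i
    simp [Matrix.mulVec, dotProduct, hV1]
    field_simp [hrpos.ne']
  conv_lhs => rw [e]
  rw [Matrix.mulVec_mulVec, hV, Matrix.one_mulVec]

theorem ds_exists_unitary_pair {κ : Type*} [Fintype κ] [DecidableEq κ] [Nonempty κ] (v u : κ → ℂ)
    (h : ∑ i, ‖v i‖ ^ 2 = ∑ i, ‖u i‖ ^ 2) :
    ∃ V : Matrix κ κ ℂ, star V * V = 1 ∧ V.mulVec v = u := by
  obtain ⟨i0⟩ := ‹Nonempty κ›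
  obtain ⟨V, hV, hV1⟩ := ds_exists_unitary_col i0 v
  obtain ⟨W, hW, hW1⟩ := ds_exists_unitary_col i0 u
  refine ⟨star W * V, ?_, ?_⟩
  · rw [star_mul, star_star, mul_assoc, ← mul_assoc W, mul_eq_one_comm.1 hW, one_mul, hV]
  · rw [← Matrix.mulVec_mulVec, hV1, h, ← hW1, Matrix.mulVec_mulVec, hW, Matrix.one_mulVec]

theorem ds_mp_of_preimage {E : Type*} [NormedAddCommGroup E] [NormedSpace ℝ E]
    [FiniteDimensional ℝ E] [MeasurableSpace E] [BorelSpace E] (μ : Measure E)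
    [μ.IsAddHaarMeasure] (L : E ≃ₗ[ℝ] E) (S : Set E) (hS : MeasurableSet S)
    (hL : ∀ x, L x ∈ S ↔ x ∈ S) (h0 : μ S ≠ 0) (h1 : μ S ≠ ⊤) : MeasurePreserving L μ μ := by
  have hm : Measurable L := (LinearMap.continuous_of_finiteDimensional L.toLinearMap).measurable
  refine ⟨hm, ?_⟩
  have hdet : LinearMap.det (L : E →ₗ[ℝ] E) ≠ 0 := L.isUnit_det'.ne_zero
  have h := Measure.map_linearMap_addHaar_eq_smul_addHaar μ hdet
  have h' : Measure.map L μ = ENNReal.ofReal |(LinearMap.det (L : E →ₗ[ℝ] E))⁻¹| • μ := h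
  have e := congrArg (fun ν : Measure E => ν S) h'
  simp only [Measure.map_apply hm hS, Measure.smul_apply, smul_eq_mul] at e
  have e2 : L ⁻¹' S = S := by ext x; exact hL x
  rw [e2] at e
  have e3 : ENNReal.ofReal |(LinearMap.det (L : E →ₗ[ℝ] E))⁻¹| = 1 := by
    have := ENNReal.mul_eq_right (a := ENNReal.ofReal |(LinearMap.det (L : E →ₗ[ℝ] E))⁻¹|) h0 h1
    exact this.1 e.symm
  rw [h', e3, one_smul]

section SetFacts
variable {m : ℕ} {S : Set (Matrix (Unit ⊕ Fin m) (Unit ⊕ Fin m) ℂ)}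

theorem dsEquiv_symm_snd (M : Matrix (Unit ⊕ Fin m) (Unit ⊕ Fin m) ℂ) (i : Fin m) :
    ((dsEquiv m).symm M).2 i = M (Sum.inr i) (Sum.inl ()) := rfl

theorem dsTri_of (M : Matrix (Unit ⊕ Fin m) (Unit ⊕ Fin m) ℂ)
    (h : ((dsEquiv m).symm M).2 = 0) : dsMat ((dsEquiv m).symm M).1 0 = M := by
  rw [← h, ← dsEquiv_apply]; simp

/-- Pullback of `S` to all parameters. -/
def dsSE (S : Set (Matrix (Unit ⊕ Fin m) (Unit ⊕ Fin m) ℂ)) : Set (DsE m) :=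
  {p | dsMat p.1 p.2 ∈ S}

/-- Pullback of `S` to block triangular parameters. -/
def dsST (S : Set (Matrix (Unit ⊕ Fin m) (Unit ⊕ Fin m) ℂ)) : Set (DsT m) :=
  {T | dsMat T 0 ∈ S}

theorem DsSet.open_SE (hS : DsSet S) : IsOpen (dsSE S) := hS.isOpen.preimage (dsMat_cont m)

theorem DsSet.open_ST (hS : DsSet S) : IsOpen (dsST S) := hS.isOpen.preimage (dsMat0_cont m)

theorem DsSet.bdd_SE (hS : DsSet S) : Bornology.IsBounded (dsSE S) := by
  obtain ⟨C, hC⟩ := hS.bdd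
  rw [isBounded_iff_forall_norm_le]
  refine ⟨C, fun p hp => ?_⟩
  have h := hC _ hp
  have hC0 : 0 ≤ C := (norm_nonneg _).trans (h (Sum.inl ()) (Sum.inl ()))
  refine max_le (max_le ?_ (max_le ?_ ?_)) ?_
  · refine (pi_norm_le_iff_of_nonneg hC0).2 (fun j => ?_)
    simpa [dsMat] using h (Sum.inl ()) (Sum.inr j)
  · simpa [dsMat] using h (Sum.inl ()) (Sum.inl ())
  · refine (pi_norm_le_iff_of_nonneg hC0).2 (fun i => (pi_norm_le_iff_of_nonneg hC0).2
      (fun j => ?_))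
    simpa [dsMat] using h (Sum.inr i) (Sum.inr j)
  · refine (pi_norm_le_iff_of_nonneg hC0).2 (fun j => ?_)
    simpa [dsMat] using h (Sum.inr j) (Sum.inl ())

theorem DsSet.bdd_ST (hS : DsSet S) : Bornology.IsBounded (dsST S) := by
  have h := hS.bdd_SE
  rw [isBounded_iff_forall_norm_le] at h ⊢
  obtain ⟨C, hC⟩ := h
  exact ⟨C, fun T hT => (le_max_left _ _).trans (hC (T, 0) hT)⟩

theorem DsSet.nonempty_ST (hS : DsSet S) : (dsST S).Nonempty := by
  obtain ⟨M, hM⟩ := hS.nonempty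
  obtain ⟨V, hV, hV1⟩ := ds_exists_unitary_col (Sum.inl ()) (fun i => M i (Sum.inl ()))
  have hVM := hS.left V M hV hM
  refine ⟨((dsEquiv m).symm (V * M)).1, ?_⟩
  have h2 : ((dsEquiv m).symm (V * M)).2 = 0 := by
    ext i
    have := congrFun hV1 (Sum.inr i)
    simp only [reduceCtorEq, if_false] at this
    exact this
  have h3 := dsTri_of _ h2
  change dsMat _ 0 ∈ S
  rw [h3]; exact hVM

theorem DsSet.nonempty_SE (hS : DsSet S) : (dsSE S).Nonempty := by
  obtain ⟨T, hT⟩ := hS.nonempty_ST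
  exact ⟨(T, 0), hT⟩

theorem DsSet.vol_SE_ne_zero (hS : DsSet S) : volume (dsSE S) ≠ 0 :=
  (hS.open_SE.measure_pos _ hS.nonempty_SE).ne'

theorem DsSet.vol_ST_ne_zero (hS : DsSet S) : volume (dsST S) ≠ 0 :=
  (hS.open_ST.measure_pos _ hS.nonempty_ST).ne'

theorem DsSet.vol_SE_ne_top (hS : DsSet S) : volume (dsSE S) ≠ ⊤ :=
  hS.bdd_SE.measure_lt_top.ne

theorem DsSet.vol_ST_ne_top (hS : DsSet S) : volume (dsST S) ≠ ⊤ :=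
  hS.bdd_ST.measure_lt_top.ne

/-- Left multiplication in parameters. -/
noncomputable def dsLeft (U V : Matrix (Unit ⊕ Fin m) (Unit ⊕ Fin m) ℂ) (h : V * U = 1) :
    DsE m ≃ₗ[ℝ] DsE m where
  toFun p := (dsEquiv m).symm (U * dsEquiv m p)
  invFun p := (dsEquiv m).symm (V * dsEquiv m p)
  map_add' p q := by simp only [map_add, mul_add]
  map_smul' c p := by
    simp only [← Complex.coe_smul, map_smul, mul_smul_comm, RingHom.id_apply]
  left_inv p := by simp [← mul_assoc, h]
  right_inv p := by simp [← mul_assoc, mul_eq_one_comm.1 h]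

/-- Right multiplication in parameters. -/
noncomputable def dsRight (U V : Matrix (Unit ⊕ Fin m) (Unit ⊕ Fin m) ℂ) (h : V * U = 1) :
    DsE m ≃ₗ[ℝ] DsE m where
  toFun p := (dsEquiv m).symm (dsEquiv m p * U)
  invFun p := (dsEquiv m).symm (dsEquiv m p * V)
  map_add' p q := by simp only [map_add, add_mul]
  map_smul' c p := by
    simp only [← Complex.coe_smul, map_smul, smul_mul_assoc, RingHom.id_apply]
  left_inv p := by simp [mul_assoc, mul_eq_one_comm.1 h]
  right_inv p := by simp [mul_assoc, h]

theorem dsLeft_apply (U V : Matrix (Unit ⊕ Fin m) (Unit ⊕ Fin m) ℂ) (h : V * U = 1) (p : DsE m) :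
    dsEquiv m (dsLeft U V h p) = U * dsEquiv m p := by simp [dsLeft]

theorem dsRight_apply (U V : Matrix (Unit ⊕ Fin m) (Unit ⊕ Fin m) ℂ) (h : V * U = 1) (p : DsE m) :
    dsEquiv m (dsRight U V h p) = dsEquiv m p * U := by simp [dsRight]

theorem DsSet.left_mp (hS : DsSet S) (U) (hU : star U * U = 1) :
    MeasurePreserving (dsLeft (m := m) U (star U) hU) volume volume := by
  refine ds_mp_of_preimage volume _ (dsSE S) hS.open_SE.measurableSet (fun p => ?_)
    hS.vol_SE_ne_zero hS.vol_SE_ne_top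
  change dsEquiv m _ ∈ S ↔ dsEquiv m p ∈ S
  rw [dsLeft_apply, hS.left_iff U _ hU]

theorem DsSet.right_mp (hS : DsSet S) (U) (hU : star U * U = 1) :
    MeasurePreserving (dsRight (m := m) U (star U) hU) volume volume := by
  refine ds_mp_of_preimage volume _ (dsSE S) hS.open_SE.measurableSet (fun p => ?_)
    hS.vol_SE_ne_zero hS.vol_SE_ne_top
  change dsEquiv m _ ∈ S ↔ dsEquiv m p ∈ S
  rw [dsRight_apply, hS.right_iff U _ hU]

/-- Phase rotation of the lower right block. -/
noncomputable def dsPhase (m : ℕ) (ζ : ℂ) (h : ζ ≠ 0) : DsT m ≃ₗ[ℝ] DsT m where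
  toFun T := (T.1, (T.2.1, ζ • T.2.2))
  invFun T := (T.1, (T.2.1, ζ⁻¹ • T.2.2))
  map_add' p q := by simp
  map_smul' c p := by ext <;> simp <;> ring
  left_inv p := by simp [smul_smul, h]
  right_inv p := by simp [smul_smul, h]

theorem DsSet.phase_iff (hS : DsSet S) (ζ : ℂ) (hζ : ‖ζ‖ = 1) (h0 : ζ ≠ 0) (T : DsT m) :
    dsPhase m ζ h0 T ∈ dsST S ↔ T ∈ dsST S := by
  let U : Matrix (Unit ⊕ Fin m) (Unit ⊕ Fin m) ℂ := Matrix.fromBlocks 1 0 0 (ζ • 1)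
  have hU : star U * U = 1 := by
    change U.conjTranspose * U = 1
    simp only [U]
    rw [Matrix.fromBlocks_conjTranspose, Matrix.fromBlocks_multiply, ← Matrix.fromBlocks_one]
    have : star ζ * ζ = 1 := by
      have := Complex.conj_mul' ζ
      rw [hζ] at this
      simpa using this
    congr 1 <;> simp [smul_smul]
    rw [mul_comm]; simp at this; simp [this]
  have e : dsMat (dsPhase m ζ h0 T) 0 = U * dsMat T 0 := by
    simp only [U, dsMat, Matrix.fromBlocks_multiply]
    congr 1
    · simp [dsPhase]
    · ext i j; simp [dsPhase]
    · ext i j; simp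
    · ext i j; simp [dsPhase]
  change dsMat _ 0 ∈ S ↔ dsMat T 0 ∈ S
  rw [e, hS.left_iff U _ hU]

theorem DsSet.phase_mp (hS : DsSet S) (ζ : ℂ) (hζ : ‖ζ‖ = 1) (h0 : ζ ≠ 0) :
    MeasurePreserving (dsPhase m ζ h0) volume volume :=
  ds_mp_of_preimage volume _ (dsST S) hS.open_ST.measurableSet
    (hS.phase_iff ζ hζ h0) hS.vol_ST_ne_zero hS.vol_ST_ne_top

theorem ds_tri_mul (a b c : DsT m) :
    ∃ d : DsT m, dsMat a 0 * dsMat b 0 * dsMat c 0 = dsMat d 0 ∧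
      d.2.1 = a.2.1 * b.2.1 * c.2.1 := by
  have h2 : ∀ a b : DsT m, ∃ d : DsT m, dsMat a 0 * dsMat b 0 = dsMat d 0 ∧
      d.2.1 = a.2.1 * b.2.1 := by
    intro a b
    refine ⟨((dsEquiv m).symm (dsMat a 0 * dsMat b 0)).1, ?_, ?_⟩
    · have h2 : ((dsEquiv m).symm (dsMat a 0 * dsMat b 0)).2 = 0 := by
        ext i
        rw [dsEquiv_symm_snd]
        simp [dsMat, Matrix.mul_apply]
      exact (dsTri_of _ h2).symm
    · simp [dsEquiv, dsMat, Matrix.mul_apply]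
  obtain ⟨d, h1, h3⟩ := h2 a b
  obtain ⟨d', h4, h5⟩ := h2 d c
  exact ⟨d', by rw [h1, h4], by rw [h5, h3]⟩

theorem dsMat0_inj {a b : DsT m} (h : dsMat a 0 = dsMat b 0) : a = b := by
  have : (a, (0 : Fin m → ℂ)) = (b, 0) := (dsEquiv m).injective h
  exact (Prod.mk.inj this).1

theorem ds_tri_conj (a c : DsT m) (h : dsMat a 0 * dsMat c 0 = 1) :
    ∃ L : DsT m ≃ₗ[ℝ] DsT m, ∀ T, dsMat (L T) 0 = dsMat a 0 * dsMat T 0 * dsMat c 0 := by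
  choose f hf _ using fun T => ds_tri_mul a T c
  choose g hg _ using fun T => ds_tri_mul c T a
  have hz : ∀ T T' : DsT m, dsMat (T + T') 0 = dsMat T 0 + dsMat T' 0 := by
    intro T T'
    have := map_add (dsEquiv m) (T, 0) (T', 0)
    simpa [dsEquiv_apply] using this
  have hsm : ∀ (r : ℝ) (T : DsT m), dsMat (r • T) 0 = r • dsMat T 0 := by
    intro r T
    have := map_smul (dsEquiv m) (r : ℂ) (T, 0)
    simpa [dsEquiv_apply] using this
  have h' := mul_eq_one_comm.1 h
  refine ⟨LinearEquiv.mk (LinearMap.mk ⟨f, ?_⟩ ?_) g ?_ ?_, fun T => (hf T).symm⟩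
  · intro T T'
    apply dsMat0_inj
    rw [← hf, hz, hz, ← hf, ← hf, mul_add, add_mul]
  · intro r T
    apply dsMat0_inj
    change dsMat (f _) 0 = dsMat (r • f T) 0
    rw [← hf, hsm, hsm, ← hf, mul_smul_comm, smul_mul_assoc]
  · intro T
    apply dsMat0_inj
    change dsMat (g (f T)) 0 = _
    rw [← hg, ← hf]
    calc _ = (dsMat c 0 * dsMat a 0) * dsMat T 0 * (dsMat c 0 * dsMat a 0) := by
          simp only [mul_assoc]
      _ = _ := by rw [h', one_mul, mul_one]
  · intro T
    apply dsMat0_inj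
    change dsMat (f (g T)) 0 = _
    rw [← hf, ← hg]
    calc _ = (dsMat a 0 * dsMat c 0) * dsMat T 0 * (dsMat a 0 * dsMat c 0) := by
          simp only [mul_assoc]
      _ = _ := by rw [h, one_mul, mul_one]

theorem DsSet.exists_conj (hS : DsSet S) (x : Fin m → ℂ) :
    ∃ L : DsT m ≃ₗ[ℝ] DsT m, ∀ T, (L T ∈ dsST S ↔ dsN x * dsMat T 0 * dsN (-x) ∈ S) ∧
      (L T).2.1 = T.2.1 ∧ dsDet (L T) = dsDet T ∧
      (dsMat (L T) 0).charpoly = (dsMat T 0).charpoly := by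
  obtain ⟨Q, hQ, hQ1⟩ := ds_exists_unitary_col (Sum.inl ()) (fun i => dsN x i (Sum.inl ()))
  have hQ' := mul_eq_one_comm.1 hQ
  have hN := dsN_mul_inv x
  have hN' := mul_eq_one_comm.1 hN
  have hbc : (Q * dsN x) * (dsN (-x) * star Q) = 1 := by
    rw [mul_assoc, ← mul_assoc (dsN x), hN, one_mul, hQ']
  have hcb := mul_eq_one_comm.1 hbc
  have hb2 : ((dsEquiv m).symm (Q * dsN x)).2 = 0 := by
    ext i
    have := congrFun hQ1 (Sum.inr i)
    simp only [reduceCtorEq, if_false] at this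
    exact this
  set a := ((dsEquiv m).symm (Q * dsN x)).1 with ha
  have hb3 : Q * dsN x = dsMat a 0 := (dsTri_of _ hb2).symm
  set B' := dsN (-x) * star Q with hB'
  set c := ((dsEquiv m).symm B').1 with hc
  rw [hb3] at hcb hbc
  have h11 : B' (Sum.inl ()) (Sum.inl ()) * a.2.1 = 1 := by
    have := congrFun (congrFun hcb (Sum.inl ())) (Sum.inl ())
    simpa [Matrix.mul_apply, dsMat] using this
  have ha0 : a.2.1 ≠ 0 := right_ne_zero_of_mul_eq_one h11
  have hc2 : ((dsEquiv m).symm B').2 = 0 := by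
    ext i
    have := congrFun (congrFun hcb (Sum.inr i)) (Sum.inl ())
    simp [Matrix.mul_apply, dsMat, ha0] at this
    rw [dsEquiv_symm_snd]
    simpa using this
  have hc3 : B' = dsMat c 0 := (dsTri_of _ hc2).symm
  have hca : c.2.1 * a.2.1 = 1 := by
    rw [hc3] at h11; simpa [dsMat] using h11
  rw [hc3] at hbc hcb
  obtain ⟨L, hL⟩ := ds_tri_conj a c hbc
  refine ⟨L, fun T => ?_⟩
  have h21 : (L T).2.1 = T.2.1 := by
    obtain ⟨d, hd, hd1⟩ := ds_tri_mul a T c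
    rw [← hL] at hd
    rw [dsMat0_inj hd, hd1]
    linear_combination T.2.1 * hca
  have hch : (dsMat (L T) 0).charpoly = (dsMat T 0).charpoly := by
    rw [hL, Matrix.charpoly_mul_comm, ← mul_assoc, hcb, one_mul]
  refine ⟨?_, h21, ?_, hch⟩
  · change dsMat (L T) 0 ∈ S ↔ _
    have e : dsMat (L T) 0 = Q * (dsN x * dsMat T 0 * dsN (-x)) * star Q := by
      rw [hL, ← hb3, ← hc3, hB']; simp only [mul_assoc]
    rw [e, hS.right_iff _ _ (by rw [star_star]; exact hQ'), hS.left_iff _ _ hQ]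
  · rw [dsMat_charpoly, dsMat_charpoly, h21] at hch
    have := mul_left_cancel₀ (Polynomial.X_sub_C_ne_zero _) hch
    rw [dsDet_eq_eval, dsDet_eq_eval, this, h21]

end SetFacts

section Conj
variable {m : ℕ} {S : Set (Matrix (Unit ⊕ Fin m) (Unit ⊕ Fin m) ℂ)}

/-- Triangular parameters conjugated into `S` by the unipotent matrix. -/
def dsSX (S : Set (Matrix (Unit ⊕ Fin m) (Unit ⊕ Fin m) ℂ)) (x : Fin m → ℂ) : Set (DsT m) :=
  {T | dsN x * dsMat T 0 * dsN (-x) ∈ S}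

/-- Functions of conjugation invariants. -/
def DsInv {β : Type*} (k : DsT m → β) : Prop :=
  ∀ T T' : DsT m, T'.2.1 = T.2.1 → dsDet T' = dsDet T →
    (dsMat T' 0).charpoly = (dsMat T 0).charpoly → k T' = k T

theorem DsSet.exists_const (hS : DsSet S) (x : Fin m → ℂ) :
    ∃ c : ENNReal, c ≠ ⊤ ∧ (∀ k : DsT m → ENNReal, DsInv k →
      ∫⁻ T in dsSX S x, k T = c * ∫⁻ T in dsST S, k T) ∧
      ∀ k : DsT m → ℂ, DsInv k → ∫ T in dsSX S x, k T = c.toReal • ∫ T in dsST S, k T := by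
  obtain ⟨L, hL⟩ := hS.exists_conj x
  have hdet : LinearMap.det (L : DsT m →ₗ[ℝ] DsT m) ≠ 0 := L.isUnit_det'.ne_zero
  have h := Measure.map_linearMap_addHaar_eq_smul_addHaar (volume : Measure (DsT m)) hdet
  have h' : Measure.map L volume = ENNReal.ofReal |(LinearMap.det (L : DsT m →ₗ[ℝ] DsT m))⁻¹| •
    (volume : Measure (DsT m)) := h
  have hemb : MeasurableEmbedding L :=
    (L.toContinuousLinearEquiv.toHomeomorph).measurableEmbedding
  have hpre : dsSX S x = L ⁻¹' (dsST S) := by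
    ext T; exact ((hL T).1).symm
  refine ⟨ENNReal.ofReal |(LinearMap.det (L : DsT m →ₗ[ℝ] DsT m))⁻¹|, ENNReal.ofReal_ne_top,
    ?_, ?_⟩
  · intro k hk
    have hkL : ∀ T, k (L T) = k T := fun T => hk _ _ (hL T).2.1 (hL T).2.2.1 (hL T).2.2.2
    rw [← smul_eq_mul, ← lintegral_smul_measure, ← Measure.restrict_smul, ← h',
      hemb.restrict_map, hemb.lintegral_map, hpre]
    simp only [hkL]
  · intro k hk
    have hkL : ∀ T, k (L T) = k T := fun T => hk _ _ (hL T).2.1 (hL T).2.2.1 (hL T).2.2.2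
    rw [← integral_smul_measure, ← Measure.restrict_smul, ← h', hemb.setIntegral_map, hpre]
    simp only [hkL]

theorem dsDet_cont (m : ℕ) : Continuous (dsDet : DsT m → ℂ) := by
  unfold dsDet
  refine Continuous.matrix_det ?_
  refine Continuous.sub (by fun_prop) ?_
  exact continuous_snd.comp continuous_snd

theorem ds_intOn {E F : Type*} [NormedAddCommGroup E] [NormedSpace ℝ E] [FiniteDimensional ℝ E]
    [MeasurableSpace E] [BorelSpace E] [NormedAddCommGroup F] [SecondCountableTopology F] (μ : Measure E) [μ.IsAddHaarMeasure] (s : Set E)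
    (hs : Bornology.IsBounded s) (f : E → F) (hf : Continuous f) : IntegrableOn f s μ := by
  have : ProperSpace E := FiniteDimensional.proper ℝ E
  exact (hf.continuousOn.integrableOn_compact hs.isCompact_closure).mono_set subset_closure

/-- The normalizing integral. -/
noncomputable def dsA (S : Set (Matrix (Unit ⊕ Fin m) (Unit ⊕ Fin m) ℂ)) : ENNReal :=
  ∫⁻ T in dsST S, ENNReal.ofReal (Complex.normSq (dsDet T))

theorem ds_normSq_cont (m : ℕ) : Continuous (fun T : DsT m => Complex.normSq (dsDet T)) :=
  Complex.continuous_normSq.comp (dsDet_cont m)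

theorem DsSet.A_ne_top (hS : DsSet S) : dsA S ≠ ⊤ := by
  have h := ds_intOn volume (dsST S) hS.bdd_ST _ (ds_normSq_cont m)
  have h2 := (hasFiniteIntegral_iff_ofReal
    (Filter.Eventually.of_forall fun T => Complex.normSq_nonneg _)).1 h.2
  exact h2.ne

theorem DsSet.A_ne_zero (hS : DsSet S) : dsA S ≠ 0 := by
  have hmeas : Measurable fun T : DsT m => ENNReal.ofReal (Complex.normSq (dsDet T)) :=
    (ds_normSq_cont m).measurable.ennreal_ofReal
  have hopen : IsOpen ({T : DsT m | dsDet T ≠ 0} ∩ dsST S) :=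
    (isOpen_ne_fun (dsDet_cont m) continuous_const).inter hS.open_ST
  have hne : ({T : DsT m | dsDet T ≠ 0} ∩ dsST S).Nonempty := by
    by_contra hcon
    rw [Set.not_nonempty_iff_eq_empty] at hcon
    obtain ⟨T0, hT0⟩ := hS.nonempty_ST
    have hc : Continuous (fun s : ℂ => ((T0.1, (s, T0.2.2)) : DsT m)) := by fun_prop
    have ho : IsOpen ((fun s : ℂ => ((T0.1, (s, T0.2.2)) : DsT m)) ⁻¹' dsST S) :=
      hS.open_ST.preimage hc
    have hinf : ((fun s : ℂ => ((T0.1, (s, T0.2.2)) : DsT m)) ⁻¹' dsST S).Infinite :=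
      infinite_of_mem_nhds T0.2.1 (ho.mem_nhds hT0)
    have hroot := Polynomial.finite_setOfPred_isRoot
      (Matrix.charpoly_monic (Matrix.of T0.2.2)).ne_zero
    refine hinf (hroot.subset ?_)
    intro s hs
    by_contra hs2
    have : ((T0.1, (s, T0.2.2)) : DsT m) ∈ ({T : DsT m | dsDet T ≠ 0} ∩ dsST S) := by
      refine ⟨?_, hs⟩
      change dsDet _ ≠ 0
      rw [dsDet_eq_eval]
      exact hs2
    rw [hcon] at this
    exact this
  have := (setLIntegral_pos_iff (μ := volume) (s := dsST S) hmeas).2 (by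
    have e : (Function.support fun T : DsT m => ENNReal.ofReal (Complex.normSq (dsDet T))) =
        {T : DsT m | dsDet T ≠ 0} := by
      ext T
      simp [Function.mem_support, Complex.normSq_pos]
    rw [e]
    exact hopen.measure_pos _ hne)
  exact this.ne'

theorem ds_fiber_ae (a : DsT m) (hg : DsGood a.1 a.2.2) :
    ∀ᵐ b : Fin m → ℂ, ∃ R : Finset (Fin m → ℂ),
      (∀ x, x ∈ R ↔ (dsPhi a x = b ∧ ((dsPhi' a x).restrictScalars ℝ).det ≠ 0)) ∧
      ∑ x ∈ R, (dsShear x a).2.1 ^ m / dsDet (dsShear x a) = 1 ∧ R.card ≤ m + 1 := by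
  have h0 := addHaar_image_eq_zero_of_det_fderivWithin_eq_zero (volume : Measure (Fin m → ℂ))
    (s := {x | ((dsPhi' a x).restrictScalars ℝ).det = 0})
    (fun x _ => (dsPhi_hasFDerivAt a x).hasFDerivWithinAt) (fun x hx => hx)
  rw [measure_eq_zero_iff_ae_notMem] at h0
  filter_upwards [h0] with b hb
  have hb' : ∀ x, dsPhi a x = b → ((dsPhi' a x).restrictScalars ℝ).det ≠ 0 :=
    fun x hx h => hb ⟨x, h, hx⟩
  obtain ⟨R, h1, h2, h3⟩ := ds_fiber a hg b (by
    intro x hx h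
    refine hb' x hx ?_
    rw [dsPhi'_det, h, map_zero])
  refine ⟨R, fun x => ?_, h2, h3⟩
  rw [h1]
  exact ⟨fun h => ⟨h, hb' x h⟩, fun h => h.1⟩

theorem dsShear_cont (m : ℕ) :
    Continuous (fun p : (Fin m → ℂ) × DsT m => dsShear p.1 p.2) := by
  unfold dsShear
  simp only [dotProduct]
  fun_prop

theorem ds_hC (a : DsT m) :
    MeasurableSet {x | ((dsPhi' a x).restrictScalars ℝ).det ≠ 0} := by
  simp only [dsPhi'_det]
  have hc : Continuous (fun x : Fin m → ℂ => dsShear x a) :=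
    (dsShear_cont m).comp (by fun_prop : Continuous fun x : Fin m → ℂ => (x, a))
  exact (isOpen_ne_fun ((ds_normSq_cont m).comp hc) continuous_const).measurableSet

theorem dsN_cont (m : ℕ) : Continuous (dsN : (Fin m → ℂ) → _) := by
  unfold dsN
  refine Continuous.matrix_fromBlocks continuous_const continuous_const ?_ continuous_const
  exact continuous_matrix (fun i j => continuous_apply i)

theorem ds_conj_cont (m : ℕ) :
    Continuous (fun p : (Fin m → ℂ) × DsT m => dsN p.1 * dsMat p.2 0 * dsN (-p.1)) := by
  refine Continuous.matrix_mul (Continuous.matrix_mul ?_ ?_) ?_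
  · exact (dsN_cont m).comp continuous_fst
  · exact (dsMat0_cont m).comp continuous_snd
  · exact (dsN_cont m).comp continuous_fst.neg

theorem DsSet.measSX (hS : DsSet S) :
    MeasurableSet {p : (Fin m → ℂ) × DsT m | p.2 ∈ dsSX S p.1} :=
  (hS.isOpen.preimage (ds_conj_cont m)).measurableSet

theorem DsSet.measSX' (hS : DsSet S) (x : Fin m → ℂ) : MeasurableSet (dsSX S x) :=
  (hS.isOpen.preimage ((ds_conj_cont m).comp
    (by fun_prop : Continuous fun T : DsT m => (x, T)))).measurableSet

/-- The partial integral. -/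
noncomputable def dsI (S : Set (Matrix (Unit ⊕ Fin m) (Unit ⊕ Fin m) ℂ)) (x : Fin m → ℂ) :
    ENNReal := ∫⁻ T in dsSX S x, ENNReal.ofReal (Complex.normSq (dsDet T))

/-- The joint integrand. -/
noncomputable def dsJ (S : Set (Matrix (Unit ⊕ Fin m) (Unit ⊕ Fin m) ℂ)) :
    (Fin m → ℂ) × DsT m → ENNReal :=
  Set.indicator {p | p.2 ∈ dsSX S p.1} (fun p => ENNReal.ofReal (Complex.normSq (dsDet p.2)))

theorem DsSet.measJ (hS : DsSet S) : Measurable (dsJ S) := by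
  refine Measurable.indicator ?_ hS.measSX
  exact ((ds_normSq_cont m).comp continuous_snd).measurable.ennreal_ofReal

theorem DsSet.I_eq (hS : DsSet S) (x : Fin m → ℂ) : dsI S x = ∫⁻ T, dsJ S (x, T) := by
  unfold dsI
  rw [← lintegral_indicator (hS.measSX' x)]
  rfl

theorem DsSet.measI (hS : DsSet S) : Measurable (dsI S) := by
  have : dsI S = fun x => ∫⁻ T, dsJ S (x, T) := funext hS.I_eq
  rw [this]
  exact hS.measJ.lintegral_prod_right'

theorem DsSet.lint_I (hS : DsSet S) : ∫⁻ x, dsI S x ≠ ⊤ := by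
  have e1 : ∫⁻ x, dsI S x = ∫⁻ x, ∫⁻ a, dsJ S (x, dsShear x a) := by
    refine lintegral_congr (fun x => ?_)
    rw [hS.I_eq, (dsShear_mp x).lintegral_comp (f := fun T => dsJ S (x, T))
      (hS.measJ.comp (by fun_prop))]
  have hm2 : Measurable (fun p : (Fin m → ℂ) × DsT m => dsJ S (p.1, dsShear p.1 p.2)) :=
    hS.measJ.comp (measurable_fst.prodMk (dsShear_cont m).measurable)
  have e2 : ∫⁻ x, ∫⁻ a, dsJ S (x, dsShear x a) = ∫⁻ a, ∫⁻ x, dsJ S (x, dsShear x a) :=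
    lintegral_lintegral_swap hm2.aemeasurable
  have hind : Measurable (Set.indicator (dsSE S) (fun _ => (1 : ENNReal))) :=
    measurable_const.indicator hS.open_SE.measurableSet
  have e3 : ∫⁻ a, ∫⁻ x, dsJ S (x, dsShear x a) ≤
      ∫⁻ a : DsT m, ((m + 1 : ℕ) : ENNReal) * ∫⁻ b, Set.indicator (dsSE S) (fun _ => 1) (a, b) := by
    refine lintegral_mono_ae ?_
    filter_upwards [ds_good_ae' m] with a ha
    have := ds_area_le volume (dsPhi a) (fun x => (dsPhi' a x).restrictScalars ℝ)
      (dsPhi_hasFDerivAt a) (ds_hC a) (fun b => Set.indicator (dsSE S) (fun _ => 1) (a, b))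
      (hind.comp (by fun_prop)) (m + 1) (by
        filter_upwards [ds_fiber_ae a ha] with b hb
        obtain ⟨R, h1, _, h3⟩ := hb
        exact ⟨R, h1, h3⟩)
    refine le_trans (le_of_eq (lintegral_congr (fun x => ?_))) this
    have hiff : (dsShear x a) ∈ dsSX S x ↔ (a, dsPhi a x) ∈ dsSE S := by
      change _ ∈ S ↔ dsMat a (dsPhi a x) ∈ S
      rw [dsMat_eq_conj]
    simp only [dsJ, dsPhi'_det, abs_of_nonneg (Complex.normSq_nonneg _)]
    by_cases h : (dsShear x a) ∈ dsSX S x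
    · rw [Set.indicator_of_mem (hiff.1 h), Set.indicator_of_mem (by exact h), mul_one]
    · rw [Set.indicator_of_notMem (fun h' => h (hiff.2 h')), Set.indicator_of_notMem (by exact h),
        mul_zero]
  rw [e1, e2]
  refine ne_top_of_le_ne_top ?_ e3
  rw [lintegral_const_mul _ (hind.lintegral_prod_right')]
  refine ENNReal.mul_ne_top (ENNReal.natCast_ne_top _) ?_
  have e4 := lintegral_prod (μ := (volume : Measure (DsT m))) (ν := (volume : Measure (Fin m → ℂ)))
    _ hind.aemeasurable
  rw [← e4]
  have e5 : ∫⁻ p : DsE m, (dsSE S).indicator (fun _ => (1 : ENNReal)) p = volume (dsSE S) := by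
    rw [lintegral_indicator hS.open_SE.measurableSet]; simp
  exact e5 ▸ hS.vol_SE_ne_top

/-- The scaling function. -/
theorem DsSet.exists_c (hS : DsSet S) : ∃ c : (Fin m → ℂ) → ENNReal, Measurable c ∧
    ∫⁻ x, c x ≠ ⊤ ∧ ∀ x, c x ≠ ⊤ ∧ (∀ k : DsT m → ENNReal, DsInv k →
      ∫⁻ T in dsSX S x, k T = c x * ∫⁻ T in dsST S, k T) ∧
      ∀ k : DsT m → ℂ, DsInv k → ∫ T in dsSX S x, k T = (c x).toReal • ∫ T in dsST S, k T := by
  choose c hc using hS.exists_const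
  have hcA : ∀ x, dsI S x = c x * dsA S := fun x => (hc x).2.1 _ (fun T T' _ h _ => by simp only [h])
  refine ⟨c, ?_, ?_, hc⟩
  · have : c = fun x => dsI S x / dsA S := by
      funext x
      rw [hcA, ENNReal.mul_div_cancel_right hS.A_ne_zero hS.A_ne_top]
    rw [this]
    exact hS.measI.div_const _
  · intro h
    have h1 : ∫⁻ x, dsI S x = (∫⁻ x, c x) * dsA S := by
      rw [← lintegral_mul_const' _ _ hS.A_ne_top]
      exact lintegral_congr hcA
    rw [h, ENNReal.top_mul hS.A_ne_zero] at h1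
    exact hS.lint_I h1

end Conj

section Area2
variable {m : ℕ} {S : Set (Matrix (Unit ⊕ Fin m) (Unit ⊕ Fin m) ℂ)}

/-- The weighted integrand. -/
noncomputable def dsKer (F : Matrix (Unit ⊕ Fin m) (Unit ⊕ Fin m) ℂ → ℂ)
    (p : (Fin m → ℂ) × DsT m) : ℂ :=
  F (dsN p.1 * dsMat p.2 0 * dsN (-p.1)) * (p.2.2.1 ^ m * star (dsDet p.2))

theorem dsKer_meas (F : Matrix (Unit ⊕ Fin m) (Unit ⊕ Fin m) ℂ → ℂ)
    (hFm : Measurable (fun p : DsE m => F (dsMat p.1 p.2))) : Measurable (dsKer F) := by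
  unfold dsKer
  refine Measurable.mul ?_ ?_
  · have h1 : Continuous (fun p : (Fin m → ℂ) × DsT m =>
        (dsEquiv m).symm (dsN p.1 * dsMat p.2 0 * dsN (-p.1))) :=
      (LinearMap.continuous_of_finiteDimensional (dsEquiv m).symm.toLinearMap).comp
        (ds_conj_cont m)
    have h2 := hFm.comp h1.measurable
    convert h2 using 1
    funext p
    symm
    change F (dsEquiv m ((dsEquiv m).symm _)) = _
    rw [LinearEquiv.apply_symm_apply]
  · refine Continuous.measurable ?_
    have := (dsDet_cont m).comp (continuous_snd (X := Fin m → ℂ) (Y := DsT m))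
    refine Continuous.mul (by fun_prop) ?_
    exact continuous_star.comp this

theorem DsSet.ker_int (hS : DsSet S) (F : Matrix (Unit ⊕ Fin m) (Unit ⊕ Fin m) ℂ → ℂ)
    (hFm : Measurable (fun p : DsE m => F (dsMat p.1 p.2))) (hF0 : ∀ M, M ∉ S → F M = 0)
    (C : ℝ) (hFC : ∀ M, ‖F M‖ ≤ C) : Integrable (dsKer F) := by
  obtain ⟨c, hcm, hcint, hc⟩ := hS.exists_c
  refine ⟨(dsKer_meas F hFm).aestronglyMeasurable, ?_⟩
  have hC0 : 0 ≤ C := (norm_nonneg _).trans (hFC 0)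
  let k0 : DsT m → ℝ := fun T => C * (‖T.2.1 ^ m‖ * ‖dsDet T‖)
  have hk0c : Continuous k0 := by
    have := dsDet_cont m
    fun_prop
  have hB : ∫⁻ T in dsST S, ENNReal.ofReal (k0 T) ≠ ⊤ := by
    have h := ds_intOn volume (dsST S) hS.bdd_ST _ hk0c
    exact ((hasFiniteIntegral_iff_ofReal
      (Filter.Eventually.of_forall fun T => by simp only [k0, Pi.zero_apply]; positivity)).1 h.2).ne
  have hinv : DsInv (fun T => ENNReal.ofReal (k0 T)) := by
    intro T T' h1 h2 _
    simp only [k0, h1, h2]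
  have e1 := lintegral_prod (μ := (volume : Measure (Fin m → ℂ)))
    (ν := (volume : Measure (DsT m))) (fun p => ‖dsKer F p‖ₑ) (dsKer_meas F hFm).enorm.aemeasurable
  have e2 : ∫⁻ x, ∫⁻ T, ‖dsKer F (x, T)‖ₑ ≤
      ∫⁻ x, c x * ∫⁻ T in dsST S, ENNReal.ofReal (k0 T) := by
    refine lintegral_mono (fun x => ?_)
    dsimp only
    rw [← (hc x).2.1 _ hinv, ← lintegral_indicator (hS.measSX' x)]
    refine lintegral_mono (fun T => ?_)
    dsimp only
    by_cases h : T ∈ dsSX S x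
    · rw [Set.indicator_of_mem h, ← ofReal_norm]
      refine ENNReal.ofReal_le_ofReal ?_
      simp only [dsKer, norm_mul, norm_star, k0]
      exact mul_le_mul_of_nonneg_right (hFC _) (by positivity)
    · have : F (dsN x * dsMat T 0 * dsN (-x)) = 0 := hF0 _ h
      simp [dsKer, this]
  have e3 : ∫⁻ x, c x * ∫⁻ T in dsST S, ENNReal.ofReal (k0 T) < ⊤ := by
    rw [lintegral_mul_const' _ _ hB]
    exact ENNReal.mul_lt_top hcint.lt_top hB.lt_top
  exact lt_of_eq_of_lt e1 (lt_of_le_of_lt e2 e3)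

theorem DsSet.area (hS : DsSet S) (F : Matrix (Unit ⊕ Fin m) (Unit ⊕ Fin m) ℂ → ℂ)
    (hFm : Measurable (fun p : DsE m => F (dsMat p.1 p.2))) (hF0 : ∀ M, M ∉ S → F M = 0)
    (C : ℝ) (hFC : ∀ M, ‖F M‖ ≤ C) :
    ∫ p : DsE m, F (dsMat p.1 p.2) = ∫ x, ∫ T, dsKer F (x, T) := by
  have hInteg := hS.ker_int F hFm hF0 C hFC
  -- shear
  have hmp : MeasurePreserving (fun p : (Fin m → ℂ) × DsT m => (p.1, dsShear p.1 p.2))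
      volume volume :=
    MeasurePreserving.skew_product (MeasurePreserving.id volume)
      (g := fun x a => dsShear x a) (dsShear_cont m).measurable
      (Filter.Eventually.of_forall fun x => (dsShear_mp x).map_eq)
  have hInteg2 : Integrable (fun p : (Fin m → ℂ) × DsT m => dsKer F (p.1, dsShear p.1 p.2)) :=
    hmp.integrable_comp_of_integrable hInteg
  have e1 : ∫ x, ∫ T, dsKer F (x, T) = ∫ x, ∫ a, dsKer F (x, dsShear x a) := by
    have a1 := integral_prod (μ := (volume : Measure (Fin m → ℂ)))
      (ν := (volume : Measure (DsT m))) _ hInteg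
    have a2 := integral_prod (μ := (volume : Measure (Fin m → ℂ)))
      (ν := (volume : Measure (DsT m))) _ hInteg2
    rw [← a1, ← a2]
    have := integral_map (μ := (volume : Measure ((Fin m → ℂ) × DsT m)))
      hmp.measurable.aemeasurable (f := dsKer F)
      (by rw [hmp.map_eq]; exact hInteg.1)
    rw [hmp.map_eq] at this
    exact this
  have e2 : ∫ x, ∫ a, dsKer F (x, dsShear x a) = ∫ a, ∫ x, dsKer F (x, dsShear x a) :=
    integral_integral_swap (f := fun x a => dsKer F (x, dsShear x a)) hInteg2
  have hFint : Integrable (fun p : DsE m => F (dsMat p.1 p.2)) := by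
    have : IntegrableOn (fun p : DsE m => F (dsMat p.1 p.2)) (dsSE S) :=
      Measure.integrableOn_of_bounded (M := C) hS.vol_SE_ne_top hFm.aestronglyMeasurable
        (Filter.Eventually.of_forall fun p => hFC _)
    refine (integrableOn_iff_integrable_of_support_subset ?_).1 this
    intro p hp
    by_contra h
    exact hp (hF0 _ h)
  have e3 := integral_prod (μ := (volume : Measure (DsT m)))
      (ν := (volume : Measure (Fin m → ℂ))) _ hFint
  refine Eq.trans e3 ?_
  rw [e1, e2]
  refine integral_congr_ae ?_
  have hslice := Integrable.prod_left_ae (μ := (volume : Measure (Fin m → ℂ)))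
      (ν := (volume : Measure (DsT m))) hInteg2
  filter_upwards [ds_good_ae' m, hslice] with a ha hsl
  have hpt : ∀ x, |((dsPhi' a x).restrictScalars ℝ).det| • (F (dsMat a (dsPhi a x)) *
      ((dsShear x a).2.1 ^ m / dsDet (dsShear x a))) = dsKer F (x, dsShear x a) := by
    intro x
    rw [dsPhi'_det, abs_of_nonneg (Complex.normSq_nonneg _)]
    simp only [dsKer]
    rw [dsMat_eq_conj, Complex.real_smul, Complex.normSq_eq_conj_mul_self]
    by_cases h : dsDet (dsShear x a) = 0
    · simp [h]
    · simp only [Complex.star_def]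
      field_simp
  have := ds_area volume (dsPhi a) (fun x => (dsPhi' a x).restrictScalars ℝ)
      (dsPhi_hasFDerivAt a) (ds_hC a) (fun x => (dsShear x a).2.1 ^ m / dsDet (dsShear x a))
      (fun b => F (dsMat a b)) (by
        filter_upwards [ds_fiber_ae a ha] with b hb
        obtain ⟨R, h1, h2, _⟩ := hb
        exact ⟨R, h1, h2⟩) (by simp only [hpt]; exact hsl)
  simp only [hpt] at this
  exact this.symm

end Area2

theorem ds_root_sum (m : ℕ) (ζ : ℂ) (hζ : IsPrimitiveRoot ζ (m + 1)) (l : ℂ)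
    (Y : Matrix (Fin m) (Fin m) ℂ) :
    ∑ k ∈ Finset.range (m + 1), (l • (1 : Matrix (Fin m) (Fin m) ℂ) - ζ ^ k • Y).det
      = (m + 1) * l ^ m := by
  let p : Polynomial ℂ := (Matrix.det ((Polynomial.X : Polynomial ℂ) •
    (-Y).map Polynomial.C + (l • (1 : Matrix (Fin m) (Fin m) ℂ)).map Polynomial.C))
  have hdeg : p.natDegree < m + 1 := by
    have := Polynomial.natDegree_det_X_add_C_le (-Y) (l • (1 : Matrix (Fin m) (Fin m) ℂ))
    simp only [Fintype.card_fin] at this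
    exact Nat.lt_succ_of_le this
  have h0 : p.coeff 0 = l ^ m := by
    have := Polynomial.coeff_det_X_add_C_zero (-Y) (l • (1 : Matrix (Fin m) (Fin m) ℂ))
    simp only [p]
    rw [this]; simp
  have hev : ∀ z, p.eval z = (l • (1 : Matrix (Fin m) (Fin m) ℂ) - z • Y).det := by
    intro z
    simp only [p]
    rw [← Polynomial.coe_evalRingHom, RingHom.map_det]
    congr 1
    ext i j
    simp [Matrix.one_apply, sub_eq_add_neg, add_comm]
    ring
  simp_rw [← hev]
  have e : ∀ k, p.eval (ζ ^ k) = ∑ j ∈ Finset.range (m + 1), p.coeff j * (ζ ^ k) ^ j :=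
    fun k => Polynomial.eval_eq_sum_range' hdeg _
  simp_rw [e]
  rw [Finset.sum_comm, Finset.sum_eq_single 0]
  · simp [h0]
  · intro j hj hj0
    rw [← Finset.mul_sum]
    have h1 : ∑ k ∈ Finset.range (m + 1), (ζ ^ k) ^ j = ∑ k ∈ Finset.range (m + 1), (ζ ^ j) ^ k := by
      refine Finset.sum_congr rfl (fun k _ => ?_)
      rw [← pow_mul, ← pow_mul, mul_comm]
    have h2 : ζ ^ j ≠ 1 := hζ.pow_ne_one_of_pos_of_lt hj0 (Finset.mem_range.1 hj)
    have h3 : (ζ ^ j) ^ (m + 1) = 1 := by rw [← pow_mul, mul_comm, pow_mul, hζ.pow_eq_one, one_pow]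
    have h4 := geom_sum_mul (ζ ^ j) (m + 1)
    rw [h3, sub_self] at h4
    have h5 := (mul_eq_zero.1 h4).resolve_right (sub_ne_zero.2 h2)
    rw [h1, h5, mul_zero]
  · simp

section Main1
variable {m : ℕ} {S : Set (Matrix (Unit ⊕ Fin m) (Unit ⊕ Fin m) ℂ)}

/-- Admissible spectral functions. -/
structure DsFun (S : Set (Matrix (Unit ⊕ Fin m) (Unit ⊕ Fin m) ℂ))
    (g : Matrix (Unit ⊕ Fin m) (Unit ⊕ Fin m) ℂ → ℝ) : Prop where
  meas : Measurable (fun p : DsE m => g (dsMat p.1 p.2))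
  bdd : ∃ C, ∀ M ∈ S, |g M| ≤ C
  charp : ∀ M M', M.charpoly = M'.charpoly → g M = g M'
  phase : ∀ (w : Fin m → ℂ) (l : ℂ) (Z : Fin m → Fin m → ℂ) (ζ : ℂ), ‖ζ‖ = 1 →
    g (dsMat (w, (l, ζ • Z)) 0) = g (dsMat (w, (l, Z)) 0)

theorem DsFun.meas0 {g} (hg : DsFun S g) : Measurable (fun T : DsT m => g (dsMat T 0)) :=
  hg.meas.comp (by fun_prop : Measurable fun T : DsT m => (T, (0 : Fin m → ℂ)))

theorem DsFun.intOn {g} (hS : DsSet S) (hg : DsFun S g) (f : DsT m → ℂ) (hf : Continuous f) :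
    IntegrableOn (fun T : DsT m => (g (dsMat T 0) : ℂ) * f T) (dsST S) := by
  obtain ⟨C, hC⟩ := hg.bdd
  refine Integrable.bdd_mul (c := C) (ds_intOn volume (dsST S) hS.bdd_ST f hf) ?_ ?_
  · exact (Complex.measurable_ofReal.comp hg.meas0).aestronglyMeasurable
  · rw [ae_restrict_iff' hS.open_ST.measurableSet]
    refine Filter.Eventually.of_forall (fun T hT => ?_)
    rw [Complex.norm_real]
    exact hC _ hT

theorem DsFun.phase_avg {g} (hS : DsSet S) (hg : DsFun S g) :
    ∫ T in dsST S, (g (dsMat T 0) : ℂ) * (T.2.1 ^ m * star (dsDet T)) =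
      ∫ T in dsST S, (g (dsMat T 0) : ℂ) * (T.2.1 ^ m * star (T.2.1 ^ m)) := by
  have hm1 : (m + 1 : ℕ) ≠ 0 := Nat.succ_ne_zero m
  obtain ⟨ζ, hζ⟩ : ∃ ζ : ℂ, IsPrimitiveRoot ζ (m + 1) := ⟨_, Complex.isPrimitiveRoot_exp _ hm1⟩
  have hn : ‖ζ‖ = 1 := hζ.norm'_eq_one hm1
  have hn0 : ζ ≠ 0 := by rintro rfl; simp at hn
  have hnk : ∀ k : ℕ, ‖ζ ^ k‖ = 1 := fun k => by rw [norm_pow, hn, one_pow]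
  have hcont : ∀ k : ℕ, Continuous (fun T : DsT m => T.2.1 ^ m *
      star (dsDet (dsPhase m (ζ ^ k) (pow_ne_zero k hn0) T))) := by
    intro k
    have h1 : Continuous (dsPhase m (ζ ^ k) (pow_ne_zero k hn0)) :=
      LinearMap.continuous_of_finiteDimensional (dsPhase m (ζ ^ k) (pow_ne_zero k hn0)).toLinearMap
    have h2 := (dsDet_cont m).comp h1
    exact Continuous.mul (by fun_prop) (continuous_star.comp h2)
  have hk : ∀ k : ℕ, ∫ T in dsST S, (g (dsMat T 0) : ℂ) * (T.2.1 ^ m * star (dsDet T)) =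
      ∫ T in dsST S, (g (dsMat T 0) : ℂ) * (T.2.1 ^ m *
        star (dsDet (dsPhase m (ζ ^ k) (pow_ne_zero k hn0) T))) := by
    intro k
    set L := dsPhase m (ζ ^ k) (pow_ne_zero k hn0) with hL
    have hmp := hS.phase_mp (ζ ^ k) (hnk k) (pow_ne_zero k hn0)
    have hemb : MeasurableEmbedding L :=
      (L.toContinuousLinearEquiv.toHomeomorph).measurableEmbedding
    have h1 := hmp.setIntegral_preimage_emb hemb
      (fun T => (g (dsMat T 0) : ℂ) * (T.2.1 ^ m * star (dsDet T))) (dsST S)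
    have h2 : L ⁻¹' dsST S = dsST S := by
      ext T; exact hS.phase_iff _ (hnk k) _ T
    rw [h2] at h1
    rw [← h1]
    refine integral_congr_ae (Filter.Eventually.of_forall fun T => ?_)
    have h3 : g (dsMat (L T) 0) = g (dsMat T 0) := hg.phase T.1 T.2.1 T.2.2 (ζ ^ k) (hnk k)
    have h4 : (L T).2.1 = T.2.1 := rfl
    change (g (dsMat (L T) 0) : ℂ) * ((L T).2.1 ^ m * star (dsDet (L T))) = _
    rw [h3, h4]
  have hsum : ((m + 1 : ℕ) : ℂ) * ∫ T in dsST S, (g (dsMat T 0) : ℂ) * (T.2.1 ^ m * star (dsDet T))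
      = ((m + 1 : ℕ) : ℂ) * ∫ T in dsST S, (g (dsMat T 0) : ℂ) * (T.2.1 ^ m * star (T.2.1 ^ m)) := by
    calc _ = ∑ k ∈ Finset.range (m + 1), ∫ T in dsST S, (g (dsMat T 0) : ℂ) *
            (T.2.1 ^ m * star (dsDet (dsPhase m (ζ ^ k) (pow_ne_zero k hn0) T))) := by
          rw [Finset.sum_congr rfl (fun k _ => (hk k).symm)]
          simp
      _ = ∫ T in dsST S, ∑ k ∈ Finset.range (m + 1), (g (dsMat T 0) : ℂ) *
            (T.2.1 ^ m * star (dsDet (dsPhase m (ζ ^ k) (pow_ne_zero k hn0) T))) := by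
          rw [integral_finsetSum]
          exact fun k _ => hg.intOn hS _ (hcont k)
      _ = _ := by
          rw [← integral_const_mul]
          refine integral_congr_ae (Filter.Eventually.of_forall fun T => ?_)
          dsimp only
          rw [← Finset.mul_sum, ← Finset.mul_sum, ← star_sum]
          have : ∑ k ∈ Finset.range (m + 1), dsDet (dsPhase m (ζ ^ k) (pow_ne_zero k hn0) T) =
              (m + 1) * T.2.1 ^ m := ds_root_sum m ζ hζ T.2.1 (Matrix.of T.2.2)
          rw [this]
          simp
          ring
  exact mul_left_cancel₀ (by exact_mod_cast hm1) hsum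

theorem DsSet.exists_K (hS : DsSet S) : ∃ K : ℝ, 0 ≤ K ∧ ∀ g, DsFun S g →
    ∫ p in dsSE S, g (dsMat p.1 p.2) =
      K * ∫ T in dsST S, g (dsMat T 0) * (‖T.2.1‖ ^ m) ^ 2 := by
  classical
  obtain ⟨c, hcm, hcint, hc⟩ := hS.exists_c
  refine ⟨∫ x, (c x).toReal, integral_nonneg (fun x => ENNReal.toReal_nonneg), ?_⟩
  intro g hg
  let F : Matrix (Unit ⊕ Fin m) (Unit ⊕ Fin m) ℂ → ℂ := S.indicator (fun M => (g M : ℂ))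
  obtain ⟨C, hC⟩ := hg.bdd
  have hFm : Measurable (fun p : DsE m => F (dsMat p.1 p.2)) := by
    have : (fun p : DsE m => F (dsMat p.1 p.2)) =
      (dsSE S).indicator (fun p => (g (dsMat p.1 p.2) : ℂ)) := rfl
    rw [this]
    exact (Complex.measurable_ofReal.comp hg.meas).indicator hS.open_SE.measurableSet
  have hF0 : ∀ M, M ∉ S → F M = 0 := fun M hM => Set.indicator_of_notMem hM _
  have hFC : ∀ M, ‖F M‖ ≤ C := by
    obtain ⟨M0, hM0⟩ := hS.nonempty
    intro M
    by_cases h : M ∈ S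
    · simp only [F]
      rw [Set.indicator_of_mem h, Complex.norm_real]
      exact hC M h
    · rw [hF0 M h, norm_zero]
      exact (abs_nonneg _).trans (hC M0 hM0)
  have h1 := hS.area F hFm hF0 C hFC
  have h2 : ∫ p : DsE m, F (dsMat p.1 p.2) =
      ((∫ p in dsSE S, g (dsMat p.1 p.2) : ℝ) : ℂ) := by
    rw [← integral_complex_ofReal, ← integral_indicator hS.open_SE.measurableSet]
    rfl
  have h3 : ∀ x, ∫ T, dsKer F (x, T) = (c x).toReal •
      ∫ T in dsST S, (g (dsMat T 0) : ℂ) * (T.2.1 ^ m * star (dsDet T)) := by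
    intro x
    rw [← (hc x).2.2, ← integral_indicator (hS.measSX' x)]
    · refine integral_congr_ae (Filter.Eventually.of_forall fun T => ?_)
      dsimp only
      have hch : g (dsN x * dsMat T 0 * dsN (-x)) = g (dsMat T 0) := by
        refine hg.charp _ _ ?_
        rw [Matrix.charpoly_mul_comm, ← Matrix.mul_assoc, mul_eq_one_comm.1 (dsN_mul_inv x),
          one_mul]
      by_cases h : T ∈ dsSX S x
      · rw [Set.indicator_of_mem h]
        simp only [dsKer, F]
        rw [Set.indicator_of_mem (by exact h), hch]
      · rw [Set.indicator_of_notMem h]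
        simp only [dsKer, F]
        rw [Set.indicator_of_notMem (by exact h), zero_mul]
    · intro T T' e1 e2 e3
      simp only [e1, e2, hg.charp _ _ e3]
  have h4 : ∫ T in dsST S, (g (dsMat T 0) : ℂ) * (T.2.1 ^ m * star (T.2.1 ^ m)) =
      ((∫ T in dsST S, g (dsMat T 0) * (‖T.2.1‖ ^ m) ^ 2 : ℝ) : ℂ) := by
    rw [← integral_complex_ofReal]
    refine integral_congr_ae (Filter.Eventually.of_forall fun T => ?_)
    have := Complex.mul_conj' (T.2.1 ^ m)
    simp only [Complex.star_def, this]
    simp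
  rw [h2] at h1
  simp_rw [h3] at h1
  rw [hg.phase_avg hS, h4, integral_smul_const, Complex.real_smul] at h1
  exact_mod_cast h1

end Main1

theorem ds_fubini_radial {X E Q : Type*} [NormedAddCommGroup X] [NormedSpace ℝ X]
    [FiniteDimensional ℝ X] [MeasurableSpace X] [BorelSpace X]
    [NormedAddCommGroup E] [NormedSpace ℝ E] [Nontrivial E]
    [FiniteDimensional ℝ E] [MeasurableSpace E] [BorelSpace E]
    [NormedAddCommGroup Q] [NormedSpace ℝ Q]
    [FiniteDimensional ℝ Q] [MeasurableSpace Q] [BorelSpace Q]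
    (μ : Measure X) [μ.IsAddHaarMeasure] (κ : Measure Q) [κ.IsAddHaarMeasure]
    (Φ : X ≃L[ℝ] E × Q) (s : Set X) (hs : MeasurableSet s) (hb : Bornology.IsBounded s)
    (h : ℝ → ℝ) (hh : ∀ e : E, (κ {q | Φ.symm (e, q) ∈ s}).toReal = h ‖e‖) :
    ∃ c : ℝ, 0 < c ∧ ∀ G : ℝ → ℝ, Continuous G →
      ∫ x in s, G ‖(Φ x).1‖ ∂μ =
        c * ∫ r in Set.Ioi (0 : ℝ), r ^ (Module.finrank ℝ E - 1) * (G r * h r) := by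
  have : ProperSpace X := FiniteDimensional.proper ℝ X
  have : ProperSpace E := FiniteDimensional.proper ℝ E
  have : ProperSpace Q := FiniteDimensional.proper ℝ Q
  have : SecondCountableTopology X := inferInstance
  have : SecondCountableTopology E := inferInstance
  have : SecondCountableTopology Q := inferInstance
  let η : Measure E := Measure.addHaar
  have : (η.prod κ).IsAddHaarMeasure := Measure.prod.instIsAddHaarMeasure η κ
  have : BorelSpace (E × Q) := Prod.borelSpace
  have : (Measure.map Φ.symm (η.prod κ)).IsAddHaarMeasure :=
    ContinuousLinearEquiv.isAddHaarMeasure_map Φ.symm (η.prod κ)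
  have hμ := Measure.isAddLeftInvariant_eq_smul μ (Measure.map Φ.symm (η.prod κ))
  set d := Measure.addHaarScalarFactor μ (Measure.map Φ.symm (η.prod κ)) with hd
  have hd0 : 0 < d := Measure.addHaarScalarFactor_pos_of_isAddHaarMeasure _ _
  have hball : 0 < η.real (Metric.ball (0 : E) 1) := by
    rw [measureReal_def]
    exact ENNReal.toReal_pos (Metric.measure_ball_pos η 0 one_pos).ne' measure_ball_lt_top.ne
  have hfr : 0 < Module.finrank ℝ E := Module.finrank_pos
  refine ⟨d * (Module.finrank ℝ E * η.real (Metric.ball (0 : E) 1)), by positivity, ?_⟩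
  intro G hG
  have hemb : MeasurableEmbedding Φ.symm := Φ.symm.toHomeomorph.measurableEmbedding
  have hcont : Continuous (fun x : X => G ‖(Φ x).1‖) := by fun_prop
  have hInteg : IntegrableOn (fun x : X => G ‖(Φ x).1‖) s (Measure.map Φ.symm (η.prod κ)) :=
    ds_intOn _ s hb _ hcont
  have hInteg2 := (hemb.integrable_map_iff).1 ((integrable_indicator_iff hs).2 hInteg)
  have key : ∫ x in s, G ‖(Φ x).1‖ ∂(Measure.map Φ.symm (η.prod κ)) =
      ∫ e, G ‖e‖ * h ‖e‖ ∂η := by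
    rw [← integral_indicator hs, hemb.integral_map]
    change Integrable (fun y : E × Q => _) (η.prod κ) at hInteg2
    refine (integral_prod _ hInteg2).trans ?_
    refine integral_congr_ae (Filter.Eventually.of_forall fun e => ?_)
    dsimp only
    have hms : MeasurableSet {q | Φ.symm (e, q) ∈ s} := by
      have : Continuous fun q : Q => Φ.symm (e, q) := by fun_prop
      exact this.measurable hs
    have : (fun q => s.indicator (fun x => G ‖(Φ x).1‖) (Φ.symm (e, q))) =
        {q | Φ.symm (e, q) ∈ s}.indicator (fun _ => G ‖e‖) := by
      ext q
      by_cases hq : Φ.symm (e, q) ∈ s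
      · rw [Set.indicator_of_mem hq, Set.indicator_of_mem (show q ∈ {q | Φ.symm (e, q) ∈ s} from hq),
          Φ.apply_symm_apply]
      · rw [Set.indicator_of_notMem hq,
          Set.indicator_of_notMem (show q ∉ {q | Φ.symm (e, q) ∈ s} from hq)]
    change ∫ q, s.indicator (fun x => G ‖(Φ x).1‖) (Φ.symm (e, q)) ∂κ = _
    rw [this, integral_indicator hms, setIntegral_const, smul_eq_mul, measureReal_def, hh, mul_comm]
  have hpol := integral_fun_norm_addHaar η (fun r => G r * h r)
  rw [hμ, Measure.restrict_smul, integral_smul_nnreal_measure, key, hpol]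
  simp only [smul_eq_mul, nsmul_eq_mul, NNReal.smul_def]
  ring

section
open scoped Matrix.Norms.L2Operator
theorem dsNorm_entry {κ : Type*} [Fintype κ] [DecidableEq κ] (M : Matrix κ κ ℂ) (i j : κ) :
    ‖M i j‖ ≤ dsNorm M := by
  have h := Matrix.l2_opNorm_mulVec M (EuclideanSpace.single j (1 : ℂ))
  rw [EuclideanSpace.norm_single, norm_one, mul_one] at h
  refine le_trans ?_ h
  have h2 := PiLp.norm_apply_le ((EuclideanSpace.equiv κ ℂ).symm
    (M.mulVec (EuclideanSpace.single j (1 : ℂ)).ofLp)) i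
  refine le_trans (le_of_eq ?_) h2
  simp

theorem dsNorm_zero {κ : Type*} [Fintype κ] [DecidableEq κ] : dsNorm (0 : Matrix κ κ ℂ) = 0 :=
  norm_zero
end

section Col
variable {m : ℕ} {S : Set (Matrix (Unit ⊕ Fin m) (Unit ⊕ Fin m) ℂ)}

/-- The last columns. -/
abbrev DsQ (m : ℕ) := (Fin m → ℂ) × (Fin m → Fin m → ℂ)

/-- Matrix with zero first column. -/
def dsQm (m : ℕ) : DsQ m →ₗ[ℝ] Matrix (Unit ⊕ Fin m) (Unit ⊕ Fin m) ℂ where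
  toFun q := dsMat (q.1, (0, q.2)) 0
  map_add' p q := by
    ext i j; rcases i with i | i <;> rcases j with j | j <;> simp [dsMat]
  map_smul' c p := by
    ext i j; rcases i with i | i <;> rcases j with j | j <;> simp [dsMat]

/-- Forget the first column. -/
def dsQf (m : ℕ) : Matrix (Unit ⊕ Fin m) (Unit ⊕ Fin m) ℂ →ₗ[ℝ] DsQ m where
  toFun M := (fun j => M (Sum.inl ()) (Sum.inr j), fun i j => M (Sum.inr i) (Sum.inr j))
  map_add' p q := by ext <;> simp
  map_smul' c p := by ext <;> simp

theorem dsQf_Qm (U : Matrix (Unit ⊕ Fin m) (Unit ⊕ Fin m) ℂ) (q : DsQ m) :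
    dsQm m (dsQf m (U * dsQm m q)) = U * dsQm m q := by
  ext i j; rcases i with i | i <;> rcases j with j | j <;> simp [dsMat, dsQm, dsQf, Matrix.mul_apply]

theorem dsQf_Qm' (q : DsQ m) : dsQf m (dsQm m q) = q := by
  ext <;> simp [dsMat, dsQm, dsQf]

/-- Left multiplication on the last columns. -/
noncomputable def dsCol (U V : Matrix (Unit ⊕ Fin m) (Unit ⊕ Fin m) ℂ) (h : V * U = 1) : DsQ m ≃ₗ[ℝ] DsQ m where
  toFun q := dsQf m (U * dsQm m q)
  invFun q := dsQf m (V * dsQm m q)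
  map_add' p q := by simp only [map_add, mul_add]
  map_smul' c p := by simp only [map_smul, mul_smul_comm, RingHom.id_apply]
  left_inv p := by
    change dsQf m (V * dsQm m (dsQf m (U * dsQm m p))) = p
    rw [dsQf_Qm, ← mul_assoc, h, one_mul, dsQf_Qm']
  right_inv p := by
    change dsQf m (U * dsQm m (dsQf m (V * dsQm m p))) = p
    rw [dsQf_Qm, ← mul_assoc, mul_eq_one_comm.1 h, one_mul, dsQf_Qm']

theorem dsCol_mat (U V : Matrix (Unit ⊕ Fin m) (Unit ⊕ Fin m) ℂ) (h : V * U = 1) (q : DsQ m)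
    (a a' : ℂ) (b b' : Fin m → ℂ)
    (hU : U.mulVec (Sum.elim (fun _ => a) b) = Sum.elim (fun _ => a') b') :
    U * dsMat (q.1, (a, q.2)) b = dsMat ((dsCol U V h q).1, (a', (dsCol U V h q).2)) b' := by
  ext i j
  have hi := congrFun hU i
  rcases i with i | i <;> rcases j with j | j <;>
    simp [dsMat, dsCol, dsQm, dsQf, Matrix.mul_apply, Matrix.mulVec, dotProduct] at hi ⊢ <;>
    exact hi

theorem dsCol_mp (U : Matrix (Unit ⊕ Fin m) (Unit ⊕ Fin m) ℂ) (hU : star U * U = 1) :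
    MeasurePreserving (dsCol (m := m) U (star U) hU) volume volume := by
  have hc : Continuous (fun q : DsQ m => dsNorm (dsQm m q)) :=
    dsNorm_cont.comp (LinearMap.continuous_of_finiteDimensional (dsQm m))
  have ho : IsOpen {q : DsQ m | dsNorm (dsQm m q) < 1} := isOpen_lt hc continuous_const
  have hb : Bornology.IsBounded {q : DsQ m | dsNorm (dsQm m q) < 1} := by
    rw [isBounded_iff_forall_norm_le]
    refine ⟨1, fun q hq => ?_⟩
    have he := fun i j => (dsNorm_entry (dsQm m q) i j).trans (le_of_lt hq)
    refine max_le ?_ ?_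
    · refine (pi_norm_le_iff_of_nonneg zero_le_one).2 (fun j => ?_)
      simpa [dsMat, dsQm] using he (Sum.inl ()) (Sum.inr j)
    · refine (pi_norm_le_iff_of_nonneg zero_le_one).2 (fun i =>
        (pi_norm_le_iff_of_nonneg zero_le_one).2 (fun j => ?_))
      simpa [dsMat, dsQm] using he (Sum.inr i) (Sum.inr j)
  refine ds_mp_of_preimage volume _ {q : DsQ m | dsNorm (dsQm m q) < 1} ho.measurableSet
    (fun q => ?_) (ho.measure_pos _ ⟨0, ?_⟩).ne' hb.measure_lt_top.ne
  · change dsNorm (dsQm m (dsQf m (U * dsQm m q))) < 1 ↔ _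
    rw [dsQf_Qm, dsNorm_unitary_mul _ _ hU]; rfl
  · change dsNorm (dsQm m 0) < 1
    rw [map_zero, dsNorm_zero]; exact one_pos

theorem DsSet.slice_eq (hS : DsSet S) (a a' : ℂ) (b b' : Fin m → ℂ)
    (h : ‖a‖ ^ 2 + ∑ i, ‖b i‖ ^ 2 = ‖a'‖ ^ 2 + ∑ i, ‖b' i‖ ^ 2) :
    (volume {q : DsQ m | dsMat (q.1, (a, q.2)) b ∈ S}) =
      (volume {q : DsQ m | dsMat (q.1, (a', q.2)) b' ∈ S}) := by
  obtain ⟨U, hU, hUv⟩ := ds_exists_unitary_pair (Sum.elim (fun _ : Unit => a) b)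
    (Sum.elim (fun _ : Unit => a') b') (by simpa using h)
  have hmp := dsCol_mp U hU
  have hms : MeasurableSet {q : DsQ m | dsMat (q.1, (a', q.2)) b' ∈ S} := by
    have : Continuous (fun q : DsQ m => dsMat (q.1, (a', q.2)) b') :=
      (dsMat_cont m).comp (by fun_prop : Continuous fun q : DsQ m => ((q.1, (a', q.2)), b'))
    exact (hS.isOpen.preimage this).measurableSet
  rw [← hmp.measure_preimage hms.nullMeasurableSet]
  congr 1
  ext q
  change _ ↔ dsMat ((dsCol U (star U) hU q).1, (a', (dsCol U (star U) hU q).2)) b' ∈ S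
  rw [← dsCol_mat U (star U) hU q a a' b b' hUv, hS.left_iff U _ hU]
  rfl

/-- Rearrangement of the parameters. -/
noncomputable def dsPhiE (m : ℕ) : DsE m ≃ₗ[ℝ] EuclideanSpace ℂ (Unit ⊕ Fin m) × DsQ m where
  toFun p := (WithLp.toLp 2 (Sum.elim (fun _ => p.1.2.1) p.2), (p.1.1, p.1.2.2))
  invFun y := ((y.2.1, (y.1 (Sum.inl ()), y.2.2)), fun i => y.1 (Sum.inr i))
  map_add' p q := by
    refine Prod.ext ?_ rfl
    ext i; rcases i with i | i <;> simp
  map_smul' c p := by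
    refine Prod.ext ?_ rfl
    ext i; rcases i with i | i <;> simp
  left_inv p := by simp
  right_inv y := by
    refine Prod.ext ?_ rfl
    ext i; rcases i with i | i <;> simp

/-- Rearrangement of the parameters. -/
def dsPhiT (m : ℕ) : DsT m ≃ₗ[ℝ] ℂ × DsQ m where
  toFun p := (p.2.1, (p.1, p.2.2))
  invFun y := (y.2.1, (y.1, y.2.2))
  map_add' _ _ := rfl
  map_smul' _ _ := rfl
  left_inv _ := rfl
  right_inv _ := rfl

/-- Norm of the first column. -/
noncomputable def dsCn (p : DsE m) : ℝ := ‖((dsPhiE m p).1 : EuclideanSpace ℂ (Unit ⊕ Fin m))‖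

theorem DsSet.exists_polar (hS : DsSet S) : ∃ K : ℝ, ∀ G : ℝ → ℝ, Continuous G →
    ∫ p in dsSE S, G (dsCn p) = K * ∫ T in dsST S, G ‖T.2.1‖ * (‖T.2.1‖ ^ m) ^ 2 := by
  let h : ℝ → ℝ := fun r => (volume {q : DsQ m | dsMat (q.1, ((r : ℂ), q.2)) 0 ∈ S}).toReal
  obtain ⟨c1, hc1, h1⟩ := ds_fubini_radial (volume : Measure (DsE m)) (volume : Measure (DsQ m))
    (dsPhiE m).toContinuousLinearEquiv (dsSE S) hS.open_SE.measurableSet hS.bdd_SE h (by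
      intro e
      refine congrArg ENNReal.toReal ?_
      refine hS.slice_eq (e (Sum.inl ())) (‖e‖ : ℂ) (fun i => e (Sum.inr i)) 0 ?_
      rw [Complex.norm_real, norm_norm, EuclideanSpace.norm_sq_eq]
      simp)
  obtain ⟨c2, hc2, h2⟩ := ds_fubini_radial (volume : Measure (DsT m)) (volume : Measure (DsQ m))
    (dsPhiT m).toContinuousLinearEquiv (dsST S) hS.open_ST.measurableSet hS.bdd_ST h (by
      intro e
      refine congrArg ENNReal.toReal ?_
      refine hS.slice_eq _ _ _ _ ?_
      rw [Complex.norm_real, norm_norm])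
  refine ⟨c1 / c2, fun G hG => ?_⟩
  have e1 := h1 G hG
  have e2 := h2 (fun r => G r * (r ^ m) ^ 2) (by fun_prop)
  have f1 : Module.finrank ℝ (EuclideanSpace ℂ (Unit ⊕ Fin m)) = 2 * (m + 1) := by
    rw [← Module.finrank_mul_finrank ℝ ℂ, Complex.finrank_real_complex, finrank_euclideanSpace]
    simp [add_comm]
  rw [f1] at e1
  rw [Complex.finrank_real_complex] at e2
  have e3 : ∫ r in Set.Ioi (0 : ℝ), r ^ (2 * (m + 1) - 1) * (G r * h r) =
      ∫ r in Set.Ioi (0 : ℝ), r ^ (2 - 1) * (G r * (r ^ m) ^ 2 * h r) := by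
    congr 1; ext r
    have : 2 * (m + 1) - 1 = 2 * m + 1 := by omega
    rw [this]; ring
  rw [e3] at e1
  refine e1.trans ?_
  have e2' : ∫ T in dsST S, G ‖T.2.1‖ * (‖T.2.1‖ ^ m) ^ 2 = _ := e2
  rw [e2']
  field_simp

theorem dsSr_comp_dsFun (hS : DsSet S) (ψ : ℝ → ℝ) (hψ : Continuous ψ) (hm : Monotone ψ) :
    DsFun S (fun M => ψ (dsSr M)) where
  meas := by
    refine hψ.measurable.comp ?_
    refine measurable_of_tendsto_metrizable (f := fun k (p : DsE m) => dsNk k (dsMat p.1 p.2))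
      (fun k => ((dsNk_cont k).comp (dsMat_cont m)).measurable) ?_
    exact tendsto_pi_nhds.2 (fun p => dsNk_tendsto _)
  bdd := by
    have hc : Continuous (fun p : DsE m => dsNorm (dsMat p.1 p.2)) := dsNorm_cont.comp (dsMat_cont m)
    obtain ⟨C, hC⟩ := hS.bdd_SE.isCompact_closure.exists_bound_of_continuousOn hc.continuousOn
    refine ⟨|ψ 0| + |ψ C|, fun M hM => ?_⟩
    have h1 := hC ((dsEquiv m).symm M) (subset_closure (by
      change dsEquiv m ((dsEquiv m).symm M) ∈ S
      simpa using hM))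
    have h2 : dsMat ((dsEquiv m).symm M).1 ((dsEquiv m).symm M).2 = M :=
      (dsEquiv m).apply_symm_apply M
    rw [h2] at h1
    have h3 := (dsSr_le_norm M).trans ((le_abs_self _).trans h1)
    have h4 := hm h3
    have h5 := hm (dsSr_nonneg M)
    rw [abs_le]
    constructor
    · have := neg_abs_le (ψ 0); have := abs_nonneg (ψ C); linarith
    · have := le_abs_self (ψ C); have := abs_nonneg (ψ 0); linarith
  charp := fun M M' h => by rw [dsSr_charpoly M M' h]
  phase := fun w l Z ζ hζ => by rw [dsSr_phase w l Z ζ hζ]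

theorem ds_one_dsFun : DsFun S (fun _ => 1) where
  meas := measurable_const
  bdd := ⟨1, fun _ _ => by simp⟩
  charp := fun _ _ _ => rfl
  phase := fun _ _ _ _ _ => rfl

/-- Lebesgue version of the main inequality. -/
theorem DsSet.core (hS : DsSet S) (ψ : ℝ → ℝ) (hψ : Continuous ψ) (hm : Monotone ψ) :
    ∫ p in dsSE S, ψ (dsCn p) ≤ ∫ p in dsSE S, ψ (dsSr (dsMat p.1 p.2)) := by
  obtain ⟨K, hK0, hK⟩ := hS.exists_K
  obtain ⟨K', hK'⟩ := hS.exists_polar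
  have a1 := hK _ ds_one_dsFun
  have a2 := hK' (fun _ => 1) continuous_const
  have hpos : ∫ p in dsSE S, (1 : ℝ) ≠ 0 := by
    rw [setIntegral_const, smul_eq_mul, mul_one, measureReal_def]
    exact (ENNReal.toReal_pos hS.vol_SE_ne_zero hS.vol_SE_ne_top).ne'
  have hKK : K = K' := by
    have h := a1.symm.trans a2
    refine mul_right_cancel₀ (fun h0 => hpos ?_) h
    rw [a2, h0, mul_zero]
  rw [hK _ (dsSr_comp_dsFun hS ψ hψ hm), hK' ψ hψ, ← hKK]
  refine mul_le_mul_of_nonneg_left ?_ hK0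
  refine integral_mono_ae ?_ ?_ (Filter.Eventually.of_forall fun T => ?_)
  · exact ds_intOn volume _ hS.bdd_ST (fun T : DsT m => ψ ‖T.2.1‖ * (‖T.2.1‖ ^ m) ^ 2) (by fun_prop)
  · have h := (dsSr_comp_dsFun hS ψ hψ hm).intOn hS (fun T => (((‖T.2.1‖ ^ m) ^ 2 : ℝ) : ℂ))
      (by fun_prop)
    have h2 := h.re
    refine h2.congr (Filter.Eventually.of_forall fun T => ?_)
    simp [← Complex.ofReal_pow, ← Complex.ofReal_mul]
  · exact mul_le_mul_of_nonneg_right (hm (dsSr_ge_lam T)) (by positivity)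

end Col

theorem ds_mono_bd {ψ : ℝ → ℝ} (hm : Monotone ψ) {t C : ℝ} (h0 : 0 ≤ t) (h1 : t ≤ C) :
    |ψ t| ≤ |ψ 0| + |ψ C| := by
  have h4 := hm h1
  have h5 := hm h0
  rw [abs_le]
  constructor
  · have := neg_abs_le (ψ 0); have := abs_nonneg (ψ C); linarith
  · have := le_abs_self (ψ C); have := abs_nonneg (ψ 0); linarith

section
open scoped Matrix.Norms.L2Operator
theorem dsNorm_mul_unitary {κ : Type*} [Fintype κ] [DecidableEq κ] (M U : Matrix κ κ ℂ)
    (hU : star U * U = 1) : dsNorm (M * U) = dsNorm M := by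
  have h1 : dsNorm (star (M * U)) = dsNorm (M * U) := norm_star _
  have h2 : dsNorm (star M) = dsNorm M := norm_star _
  rw [← h1, star_mul, dsNorm_unitary_mul _ _ (by rw [star_star]; exact mul_eq_one_comm.1 hU), h2]

theorem dsNorm_nonneg {κ : Type*} [Fintype κ] [DecidableEq κ] (M : Matrix κ κ ℂ) : 0 ≤ dsNorm M :=
  norm_nonneg _

theorem dsNorm_lin {n : ℕ} (M : Matrix (Fin n) (Fin n) ℂ) (v : EuclideanSpace ℂ (Fin n))
    (hv : ‖v‖ = 1) : ‖Matrix.toEuclideanLin M v‖ ≤ dsNorm M := by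
  have h := Matrix.l2_opNorm_mulVec M v
  rw [hv, mul_one] at h
  exact h
end

theorem ds_lin_mul {n : ℕ} (M N : Matrix (Fin n) (Fin n) ℂ) (v : EuclideanSpace ℂ (Fin n)) :
    Matrix.toEuclideanLin (M * N) v = Matrix.toEuclideanLin M (Matrix.toEuclideanLin N v) := by
  ext i
  simp [Matrix.toLpLin_apply]

section
open scoped Matrix.Norms.L2Operator
theorem ds_lin_unitary {m : ℕ} (U : Matrix (Fin (m + 1)) (Fin (m + 1)) ℂ) (hU : star U * U = 1)
    (v : EuclideanSpace ℂ (Fin (m + 1))) : ‖Matrix.toEuclideanLin U v‖ = ‖v‖ := by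
  have hle : ∀ (U : Matrix (Fin (m + 1)) (Fin (m + 1)) ℂ) (v : EuclideanSpace ℂ (Fin (m + 1))),
      star U * U = 1 → ‖Matrix.toEuclideanLin U v‖ ≤ ‖v‖ := by
    intro U v hU
    have h := Matrix.l2_opNorm_mulVec U v
    have h2 : ‖U‖ = 1 := CStarRing.norm_of_mem_unitary
      (⟨hU, mul_eq_one_comm.1 hU⟩ : U ∈ unitary (Matrix (Fin (m + 1)) (Fin (m + 1)) ℂ))
    rw [h2, one_mul] at h
    exact h
  refine le_antisymm (hle U v hU) ?_
  have h := hle (star U) (Matrix.toEuclideanLin U v)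
    (by rw [star_star]; exact mul_eq_one_comm.1 hU)
  rw [← ds_lin_mul, hU] at h
  simpa using h
end

theorem ds_lin_cont {n : ℕ} : Continuous (fun z : Matrix (Fin n) (Fin n) ℂ ×
    EuclideanSpace ℂ (Fin n) => Matrix.toEuclideanLin z.1 z.2) := by
  have : ∀ z : Matrix (Fin n) (Fin n) ℂ × EuclideanSpace ℂ (Fin n),
    Matrix.toEuclideanLin z.1 z.2 = WithLp.toLp 2 (z.1.mulVec z.2.ofLp) := fun z => rfl
  simp_rw [this]
  refine (PiLp.continuous_toLp 2 _).comp ?_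
  exact Continuous.matrix_mulVec continuous_fst ((PiLp.continuous_ofLp 2 _).comp continuous_snd)

section Avg
variable {m : ℕ}

/-- Haar probability measure. -/
structure DsHaar (ν : Measure (Matrix (Fin (m + 1)) (Fin (m + 1)) ℂ)) : Prop where
  prob : IsProbabilityMeasure ν
  supp : ∀ᵐ U ∂ν, star U * U = 1
  inv : ∀ V : Matrix (Fin (m + 1)) (Fin (m + 1)) ℂ, star V * V = 1 →
    Measure.map (fun U => V * U) ν = ν

/-- Uniform probability measure on the sphere. -/
structure DsSph (σ : Measure (EuclideanSpace ℂ (Fin (m + 1)))) : Prop where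
  prob : IsProbabilityMeasure σ
  supp : ∀ᵐ v ∂σ, ‖v‖ = 1
  inv : ∀ V : Matrix (Fin (m + 1)) (Fin (m + 1)) ℂ, star V * V = 1 →
    Measure.map (fun v => Matrix.toEuclideanLin V v) σ = σ

instance dsMatSC (n : ℕ) : SecondCountableTopology (Matrix (Fin n) (Fin n) ℂ) :=
  inferInstanceAs (SecondCountableTopology (Fin n → Fin n → ℂ))

variable {ν : Measure (Matrix (Fin (m + 1)) (Fin (m + 1)) ℂ)}
  {σ : Measure (EuclideanSpace ℂ (Fin (m + 1)))} {ψ : ℝ → ℝ}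

theorem DsHaar.integrable (hν : DsHaar ν) (f : Matrix (Fin (m + 1)) (Fin (m + 1)) ℂ → ℝ)
    (hf : Measurable f) (C : ℝ) (hC : ∀ U, star U * U = 1 → |f U| ≤ C) : Integrable f ν := by
  have := hν.prob
  refine Integrable.of_bound hf.aestronglyMeasurable C ?_
  filter_upwards [hν.supp] with U hU
  exact hC U hU

theorem DsHaar.integral_left (hν : DsHaar ν) (f : Matrix (Fin (m + 1)) (Fin (m + 1)) ℂ → ℝ)
    (hf : Measurable f) (V) (hV : star V * V = 1) : ∫ U, f (V * U) ∂ν = ∫ U, f U ∂ν := by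
  conv_rhs => rw [← hν.inv V hV]
  rw [integral_map]
  · exact (by fun_prop : Continuous fun U => V * U).measurable.aemeasurable
  · exact hf.aestronglyMeasurable

theorem DsHaar.integral_star (hν : DsHaar ν) (f : Matrix (Fin (m + 1)) (Fin (m + 1)) ℂ → ℝ)
    (hf : Continuous f) (C : ℝ) (hC : ∀ U, star U * U = 1 → |f U| ≤ C) :
    ∫ U, f U ∂ν = ∫ U, f (star U) ∂ν := by
  have := hν.prob
  have h1 : ∫ V, ∫ U, f (star V * U) ∂ν ∂ν = ∫ U, f U ∂ν := by
    have : ∀ᵐ V ∂ν, ∫ U, f (star V * U) ∂ν = ∫ U, f U ∂ν := by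
      filter_upwards [hν.supp] with V hV
      exact hν.integral_left f hf.measurable _ (by rw [star_star]; exact mul_eq_one_comm.1 hV)
    rw [integral_congr_ae this]; simp
  have h2 : ∫ U, ∫ V, f (star V * U) ∂ν ∂ν = ∫ U, f (star U) ∂ν := by
    have : ∀ᵐ U ∂ν, ∫ V, f (star V * U) ∂ν = ∫ U, f (star U) ∂ν := by
      filter_upwards [hν.supp] with U hU
      have h := hν.integral_left (fun V => f (star V)) (by
        exact (hf.comp continuous_star).measurable) (star U)
        (by rw [star_star]; exact mul_eq_one_comm.1 hU)
      simpa [star_mul] using h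
    rw [integral_congr_ae this]; simp
  rw [← h1, ← h2]
  refine integral_integral_swap ?_
  have hc : Continuous (fun z : Matrix (Fin (m + 1)) (Fin (m + 1)) ℂ ×
    Matrix (Fin (m + 1)) (Fin (m + 1)) ℂ => f (star z.1 * z.2)) := by
    refine hf.comp ?_
    exact (continuous_star.comp continuous_fst).mul continuous_snd
  refine Integrable.of_bound hc.measurable.aestronglyMeasurable C ?_
  filter_upwards [Measure.quasiMeasurePreserving_fst.ae hν.supp,
    Measure.quasiMeasurePreserving_snd.ae hν.supp] with z hz1 hz2
  refine hC _ ?_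
  rw [star_mul, star_star, mul_assoc, ← mul_assoc z.1, mul_eq_one_comm.1 hz1, one_mul, hz2]

/-- Average of a function of the spectral radius. -/
noncomputable def dsP (ν : Measure (Matrix (Fin (m + 1)) (Fin (m + 1)) ℂ)) (ψ : ℝ → ℝ)
    (X : Matrix (Fin (m + 1)) (Fin (m + 1)) ℂ) : ℝ := ∫ U, ψ (dsSr (U * X)) ∂ν

/-- Average of a function of the Gelfand approximant. -/
noncomputable def dsPk (ν : Measure (Matrix (Fin (m + 1)) (Fin (m + 1)) ℂ)) (ψ : ℝ → ℝ) (k : ℕ)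
    (X : Matrix (Fin (m + 1)) (Fin (m + 1)) ℂ) : ℝ := ∫ U, ψ (dsNk k (U * X)) ∂ν

/-- Average of a function of the norm. -/
noncomputable def dsR (σ : Measure (EuclideanSpace ℂ (Fin (m + 1)))) (ψ : ℝ → ℝ)
    (X : Matrix (Fin (m + 1)) (Fin (m + 1)) ℂ) : ℝ := ∫ v, ψ ‖Matrix.toEuclideanLin X v‖ ∂σ

theorem dsNk_bd (hm : Monotone ψ) (k : ℕ) (U X : Matrix (Fin (m + 1)) (Fin (m + 1)) ℂ) (C : ℝ)
    (hU : star U * U = 1) (hX : dsNorm X ≤ C) : |ψ (dsNk k (U * X))| ≤ |ψ 0| + |ψ C| :=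
  ds_mono_bd hm (dsNk_nonneg _ _) ((dsNk_le _ _).trans
    ((dsNorm_unitary_mul U X hU).le.trans hX))

theorem dsSr_bd (hm : Monotone ψ) (U X : Matrix (Fin (m + 1)) (Fin (m + 1)) ℂ) (C : ℝ)
    (hU : star U * U = 1) (hX : dsNorm X ≤ C) : |ψ (dsSr (U * X))| ≤ |ψ 0| + |ψ C| :=
  ds_mono_bd hm (dsSr_nonneg _) ((dsSr_le_norm _).trans
    ((dsNorm_unitary_mul U X hU).le.trans hX))

theorem ds_nv_bd (hm : Monotone ψ) (X : Matrix (Fin (m + 1)) (Fin (m + 1)) ℂ) (v) (C : ℝ)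
    (hv : ‖v‖ = 1) (hX : dsNorm X ≤ C) :
    |ψ ‖Matrix.toEuclideanLin X v‖| ≤ |ψ 0| + |ψ C| :=
  ds_mono_bd hm (norm_nonneg _) ((dsNorm_lin X v hv).trans hX)

theorem dsSr_meas : Measurable (dsSr : Matrix (Fin (m + 1)) (Fin (m + 1)) ℂ → ℝ) :=
  measurable_of_tendsto_metrizable (f := fun k => dsNk k)
      (fun k => (dsNk_cont k).measurable) (tendsto_pi_nhds.2 (fun p => dsNk_tendsto _))

theorem ds_mulR_cont (X : Matrix (Fin (m + 1)) (Fin (m + 1)) ℂ) :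
    Continuous (fun U : Matrix (Fin (m + 1)) (Fin (m + 1)) ℂ => U * X) := by fun_prop

theorem dsPk_tendsto (hν : DsHaar ν) (hψ : Continuous ψ) (hm : Monotone ψ) (X) :
    Filter.Tendsto (fun k => dsPk ν ψ k X) Filter.atTop (nhds (dsP ν ψ X)) := by
  have := hν.prob
  refine tendsto_integral_of_dominated_convergence (fun _ => |ψ 0| + |ψ (dsNorm X)|)
    (fun k => ?_) (integrable_const _) (fun k => ?_) (Filter.Eventually.of_forall fun U => ?_)
  · exact (hψ.comp ((dsNk_cont k).comp (ds_mulR_cont X))).measurable.aestronglyMeasurable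
  · filter_upwards [hν.supp] with U hU
    exact dsNk_bd hm k U X _ hU le_rfl
  · exact (hψ.tendsto _).comp (dsNk_tendsto _)

theorem dsP_le_Pk (hν : DsHaar ν) (hψ : Continuous ψ) (hm : Monotone ψ) (k X) :
    dsP ν ψ X ≤ dsPk ν ψ k X := by
  refine integral_mono ?_ ?_ (fun U => hm (dsSr_le_Nk k _))
  · exact hν.integrable _ (hψ.measurable.comp (dsSr_meas.comp (ds_mulR_cont X).measurable)) _
      (fun U hU => dsSr_bd hm U X _ hU le_rfl)
  · exact hν.integrable _ (hψ.comp ((dsNk_cont k).comp (ds_mulR_cont X))).measurable _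
      (fun U hU => dsNk_bd hm k U X _ hU le_rfl)

theorem dsPk_cont (hν : DsHaar ν) (hψ : Continuous ψ) (hm : Monotone ψ) (k) :
    Continuous (dsPk ν ψ k) := by
  have := hν.prob
  rw [continuous_iff_continuousAt]
  intro X
  have hev : ∀ᶠ Y in nhds X, dsNorm Y < dsNorm X + 1 :=
    dsNorm_cont.continuousAt.eventually_lt_const (by linarith)
  refine continuousAt_of_dominated (bound := fun _ => |ψ 0| + |ψ (dsNorm X + 1)|)
    (Filter.Eventually.of_forall fun Y => ?_) ?_ (integrable_const _)
    (Filter.Eventually.of_forall fun U => ?_)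
  · exact (hψ.comp ((dsNk_cont k).comp (ds_mulR_cont Y))).measurable.aestronglyMeasurable
  · filter_upwards [hev] with Y hY
    filter_upwards [hν.supp] with U hU
    exact dsNk_bd hm k U Y _ hU hY.le
  · exact (hψ.comp ((dsNk_cont k).comp (by fun_prop : Continuous fun Y => U * Y))).continuousAt

theorem dsR_cont (hσ : DsSph σ) (hψ : Continuous ψ) (hm : Monotone ψ) :
    Continuous (dsR σ ψ) := by
  have := hσ.prob
  rw [continuous_iff_continuousAt]
  intro X
  have hev : ∀ᶠ Y in nhds X, dsNorm Y < dsNorm X + 1 :=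
    dsNorm_cont.continuousAt.eventually_lt_const (by linarith)
  refine continuousAt_of_dominated (bound := fun _ => |ψ 0| + |ψ (dsNorm X + 1)|)
    (Filter.Eventually.of_forall fun Y => ?_) ?_ (integrable_const _)
    (Filter.Eventually.of_forall fun v => ?_)
  · exact (hψ.comp ((ds_lin_cont.comp
      (by fun_prop : Continuous fun v => (Y, v))).norm)).measurable.aestronglyMeasurable
  · filter_upwards [hev] with Y hY
    filter_upwards [hσ.supp] with v hv
    exact ds_nv_bd hm Y v _ hv hY.le
  · exact (hψ.comp ((ds_lin_cont.comp
      (by fun_prop : Continuous fun Y => (Y, v))).norm)).continuousAt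

theorem dsP_right (hν : DsHaar ν) (hψ : Continuous ψ) (X V) (hV : star V * V = 1) :
    dsP ν ψ (X * V) = dsP ν ψ X := by
  unfold dsP
  have h := hν.integral_left (fun U => ψ (dsSr (U * X)))
    (hψ.measurable.comp (dsSr_meas.comp (ds_mulR_cont X).measurable)) V hV
  rw [← h]
  congr 1
  ext U
  rw [← mul_assoc, dsSr_charpoly (U * X * V) (V * U * X)]
  rw [Matrix.charpoly_mul_comm, mul_assoc]

theorem dsPk_star (hν : DsHaar ν) (hψ : Continuous ψ) (hm : Monotone ψ) (k : ℕ)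
    (X : Matrix (Fin (m + 1)) (Fin (m + 1)) ℂ) :
    dsPk ν ψ k X = ∫ U, ψ (dsNk k (star U * X)) ∂ν := by
  have hc : Continuous (fun U : Matrix (Fin (m + 1)) (Fin (m + 1)) ℂ => ψ (dsNk k (U * X))) :=
    hψ.comp ((dsNk_cont k).comp (ds_mulR_cont X))
  exact hν.integral_star _ hc (|ψ 0| + |ψ (dsNorm X)|)
      (fun U hU => dsNk_bd hm k U X _ hU le_rfl)

theorem dsPk_left (hν : DsHaar ν) (hψ : Continuous ψ) (hm : Monotone ψ) (k : ℕ)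
    (X V : Matrix (Fin (m + 1)) (Fin (m + 1)) ℂ)
    (hV : star V * V = 1) : dsPk ν ψ k (V * X) = dsPk ν ψ k X := by
  rw [dsPk_star hν hψ hm k (V * X), dsPk_star hν hψ hm k X]
  have hc : Continuous (fun U : Matrix (Fin (m + 1)) (Fin (m + 1)) ℂ =>
      ψ (dsNk k (star U * (V * X)))) :=
    hψ.comp ((dsNk_cont k).comp ((ds_mulR_cont (V * X)).comp continuous_star))
  have h := hν.integral_left (fun U => ψ (dsNk k (star U * (V * X)))) hc.measurable V hV
  rw [← h]
  refine integral_congr_ae (Filter.Eventually.of_forall fun U => ?_)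
  have e : star (V * U) * (V * X) = star U * X := by
    rw [star_mul, mul_assoc, ← mul_assoc (star V), hV, one_mul]
  simp only [e]

theorem dsP_left (hν : DsHaar ν) (hψ : Continuous ψ) (hm : Monotone ψ) (X V)
    (hV : star V * V = 1) : dsP ν ψ (V * X) = dsP ν ψ X := by
  refine tendsto_nhds_unique (dsPk_tendsto hν hψ hm (V * X)) ?_
  simp_rw [dsPk_left hν hψ hm _ X V hV]
  exact dsPk_tendsto hν hψ hm X

theorem dsR_left (X V : Matrix (Fin (m + 1)) (Fin (m + 1)) ℂ) (hV : star V * V = 1) :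
    dsR σ ψ (V * X) = dsR σ ψ X := by
  unfold dsR
  simp_rw [ds_lin_mul, ds_lin_unitary V hV]

theorem dsR_right (hσ : DsSph σ) (hψ : Continuous ψ) (X V : Matrix (Fin (m + 1)) (Fin (m + 1)) ℂ)
    (hV : star V * V = 1) : dsR σ ψ (X * V) = dsR σ ψ X := by
  unfold dsR
  conv_rhs => rw [← hσ.inv V hV]
  rw [integral_map]
  · simp_rw [ds_lin_mul]
  · exact (ds_lin_cont.comp (by fun_prop : Continuous fun v => (V, v))).measurable.aemeasurable
  · exact (hψ.comp ((ds_lin_cont.comp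
      (by fun_prop : Continuous fun v => (X, v))).norm)).measurable.aestronglyMeasurable

end Avg

section Final
variable {m : ℕ}

/-- An identification of index types. -/
noncomputable def dsIdx (m : ℕ) : Unit ⊕ Fin m ≃ Fin (m + 1) :=
  Fintype.equivOfCardEq (by simp [add_comm])

/-- Reindexing. -/
noncomputable def dsRe (m : ℕ) :
    Matrix (Unit ⊕ Fin m) (Unit ⊕ Fin m) ℂ ≃ₐ[ℂ] Matrix (Fin (m + 1)) (Fin (m + 1)) ℂ :=
  Matrix.reindexAlgEquiv ℂ ℂ (dsIdx m)

theorem dsRe_apply (M : Matrix (Unit ⊕ Fin m) (Unit ⊕ Fin m) ℂ) (i j) :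
    dsRe m M i j = M ((dsIdx m).symm i) ((dsIdx m).symm j) := rfl

theorem dsRe_star (M : Matrix (Unit ⊕ Fin m) (Unit ⊕ Fin m) ℂ) :
    dsRe m (star M) = star (dsRe m M) := rfl

theorem dsRe_symm_star (M : Matrix (Fin (m + 1)) (Fin (m + 1)) ℂ) :
    (dsRe m).symm (star M) = star ((dsRe m).symm M) := rfl

theorem dsRe_cont : Continuous (dsRe m) :=
  LinearMap.continuous_of_finiteDimensional (dsRe m).toLinearMap

theorem dsRe_sr (M : Matrix (Unit ⊕ Fin m) (Unit ⊕ Fin m) ℂ) : dsSr (dsRe m M) = dsSr M :=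
  dsSr_charpoly _ _ (Matrix.charpoly_reindex (dsIdx m) M)

theorem dsRe_unitary (U : Matrix (Unit ⊕ Fin m) (Unit ⊕ Fin m) ℂ) (hU : star U * U = 1) :
    star (dsRe m U) * dsRe m U = 1 := by
  rw [← dsRe_star, ← map_mul, hU, map_one]

theorem dsRe_symm_unitary (U : Matrix (Fin (m + 1)) (Fin (m + 1)) ℂ) (hU : star U * U = 1) :
    star ((dsRe m).symm U) * (dsRe m).symm U = 1 := by
  rw [← dsRe_symm_star, ← map_mul, hU, map_one]

/-- Parametrization of square matrices. -/
noncomputable def dsX (p : DsE m) : Matrix (Fin (m + 1)) (Fin (m + 1)) ℂ := dsRe m (dsMat p.1 p.2)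

theorem dsX_cont : Continuous (dsX (m := m)) := dsRe_cont.comp (dsMat_cont m)

variable {S : Set (Matrix (Unit ⊕ Fin m) (Unit ⊕ Fin m) ℂ)}
variable {ν : Measure (Matrix (Fin (m + 1)) (Fin (m + 1)) ℂ)}
  {σ : Measure (EuclideanSpace ℂ (Fin (m + 1)))} {ψ : ℝ → ℝ}

theorem DsSet.X_bd (hS : DsSet S) : ∃ C, ∀ p ∈ dsSE S, dsNorm (dsX p) ≤ C := by
  have hc : Continuous (fun p : DsE m => dsNorm (dsX p)) := dsNorm_cont.comp dsX_cont
  obtain ⟨C, hC⟩ := hS.bdd_SE.isCompact_closure.exists_bound_of_continuousOn hc.continuousOn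
  exact ⟨C, fun p hp => (le_abs_self _).trans (hC p (subset_closure hp))⟩

theorem DsSet.fubiniP (hS : DsSet S) (hν : DsHaar ν) (hψ : Continuous ψ) (hm : Monotone ψ) :
    IntegrableOn (fun p : DsE m => dsP ν ψ (dsX p)) (dsSE S) ∧
    ∫ p in dsSE S, dsP ν ψ (dsX p) = ∫ p in dsSE S, ψ (dsSr (dsMat p.1 p.2)) := by
  have := hν.prob
  have hfin : IsFiniteMeasure ((volume : Measure (DsE m)).restrict (dsSE S)) :=
    ⟨by rw [Measure.restrict_apply_univ]; exact hS.vol_SE_ne_top.lt_top⟩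
  obtain ⟨C, hC⟩ := hS.X_bd
  have hInteg : Integrable (Function.uncurry fun (p : DsE m)
      (U : Matrix (Fin (m + 1)) (Fin (m + 1)) ℂ) => ψ (dsSr (U * dsX p)))
      (((volume : Measure (DsE m)).restrict (dsSE S)).prod ν) := by
    have hc : Continuous (fun z : DsE m × Matrix (Fin (m + 1)) (Fin (m + 1)) ℂ => z.2 * dsX z.1) :=
      continuous_snd.mul (dsX_cont.comp continuous_fst)
    refine Integrable.of_bound
      (hψ.measurable.comp (dsSr_meas.comp hc.measurable)).aestronglyMeasurable (|ψ 0| + |ψ C|) ?_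
    filter_upwards [Measure.quasiMeasurePreserving_fst.ae
      (ae_restrict_mem hS.open_SE.measurableSet),
      Measure.quasiMeasurePreserving_snd.ae hν.supp] with z hz1 hz2
    exact dsSr_bd hm _ _ _ hz2 (hC _ hz1)
  refine ⟨hInteg.integral_prod_left, ?_⟩
  refine (integral_integral_swap hInteg).trans ?_
  have key : ∀ᵐ U ∂ν, ∫ p in dsSE S, ψ (dsSr (U * dsX p)) =
      ∫ p in dsSE S, ψ (dsSr (dsMat p.1 p.2)) := by
    filter_upwards [hν.supp] with U hU
    have hU' := dsRe_symm_unitary U hU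
    have hmp := hS.left_mp _ hU'
    have hemb : MeasurableEmbedding (dsLeft (m := m) _ _ hU') :=
      ((dsLeft (m := m) _ _ hU').toContinuousLinearEquiv.toHomeomorph).measurableEmbedding
    have h1 := hmp.setIntegral_preimage_emb hemb
      (fun p => ψ (dsSr (dsMat p.1 p.2))) (dsSE S)
    have h2 : dsLeft (m := m) _ _ hU' ⁻¹' dsSE S = dsSE S := by
      ext p
      change dsEquiv m _ ∈ S ↔ dsEquiv m p ∈ S
      rw [dsLeft_apply, hS.left_iff _ _ hU']
    rw [h2] at h1
    rw [← h1]
    refine integral_congr_ae (Filter.Eventually.of_forall fun p => ?_)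
    dsimp only
    rw [← dsEquiv_apply, dsLeft_apply, ← dsRe_sr, map_mul, AlgEquiv.apply_symm_apply]
    rfl
  rw [integral_congr_ae key]
  simp

theorem ds_norm_cn (p : DsE m) (v : EuclideanSpace ℂ (Fin (m + 1)))
    (V : Matrix (Unit ⊕ Fin m) (Unit ⊕ Fin m) ℂ) (hV : star V * V = 1)
    (hVv : ∀ i, V i (Sum.inl ()) = v (dsIdx m i)) :
    ‖Matrix.toEuclideanLin (dsX p) v‖ = dsCn (dsRight V (star V) hV p) := by
  unfold dsCn
  rw [EuclideanSpace.norm_eq, EuclideanSpace.norm_eq]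
  congr 1
  rw [← (dsIdx m).sum_comp]
  refine Finset.sum_congr rfl (fun i _ => ?_)
  congr 2
  have h1 : ∀ q : DsE m, (dsPhiE m q).1 i = dsEquiv m q i (Sum.inl ()) := by
    intro q
    rcases i with i | i <;> rfl
  rw [h1, dsRight_apply]
  change (dsX p).mulVec v.ofLp (dsIdx m i) = _
  rw [Matrix.mulVec, dotProduct, Matrix.mul_apply, ← (dsIdx m).sum_comp]
  refine Finset.sum_congr rfl (fun j _ => ?_)
  rw [hVv, dsX, dsRe_apply]
  simp [dsEquiv_apply]

theorem DsSet.fubiniR (hS : DsSet S) (hσ : DsSph σ) (hψ : Continuous ψ) (hm : Monotone ψ) :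
    IntegrableOn (fun p : DsE m => dsR σ ψ (dsX p)) (dsSE S) ∧
    ∫ p in dsSE S, dsR σ ψ (dsX p) = ∫ p in dsSE S, ψ (dsCn p) := by
  have := hσ.prob
  have hfin : IsFiniteMeasure ((volume : Measure (DsE m)).restrict (dsSE S)) :=
    ⟨by rw [Measure.restrict_apply_univ]; exact hS.vol_SE_ne_top.lt_top⟩
  obtain ⟨C, hC⟩ := hS.X_bd
  have hInteg : Integrable (Function.uncurry fun (p : DsE m)
      (v : EuclideanSpace ℂ (Fin (m + 1))) => ψ ‖Matrix.toEuclideanLin (dsX p) v‖)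
      (((volume : Measure (DsE m)).restrict (dsSE S)).prod σ) := by
    have hc : Continuous (fun z : DsE m × EuclideanSpace ℂ (Fin (m + 1)) =>
        ψ ‖Matrix.toEuclideanLin (dsX z.1) z.2‖) :=
      hψ.comp (ds_lin_cont.comp ((dsX_cont.comp continuous_fst).prodMk continuous_snd)).norm
    refine Integrable.of_bound hc.measurable.aestronglyMeasurable (|ψ 0| + |ψ C|) ?_
    filter_upwards [Measure.quasiMeasurePreserving_fst.ae
      (ae_restrict_mem hS.open_SE.measurableSet),
      Measure.quasiMeasurePreserving_snd.ae hσ.supp] with z hz1 hz2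
    exact ds_nv_bd hm _ _ _ hz2 (hC _ hz1)
  refine ⟨hInteg.integral_prod_left, ?_⟩
  refine (integral_integral_swap hInteg).trans ?_
  have key : ∀ᵐ v ∂σ, ∫ p in dsSE S, ψ ‖Matrix.toEuclideanLin (dsX p) v‖ =
      ∫ p in dsSE S, ψ (dsCn p) := by
    filter_upwards [hσ.supp] with v hv
    obtain ⟨V, hV, hVv⟩ := ds_exists_unitary (Sum.inl () : Unit ⊕ Fin m)
      (fun i => v (dsIdx m i)) (by
        rw [(dsIdx m).sum_comp (fun i => ‖v i‖ ^ 2), ← EuclideanSpace.norm_sq_eq, hv, one_pow])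
    have hmp := hS.right_mp V hV
    have hemb : MeasurableEmbedding (dsRight (m := m) V (star V) hV) :=
      ((dsRight (m := m) V (star V) hV).toContinuousLinearEquiv.toHomeomorph).measurableEmbedding
    have h1 := hmp.setIntegral_preimage_emb hemb (fun p => ψ (dsCn p)) (dsSE S)
    have h2 : dsRight (m := m) V (star V) hV ⁻¹' dsSE S = dsSE S := by
      ext p
      change dsEquiv m _ ∈ S ↔ dsEquiv m p ∈ S
      rw [dsRight_apply, hS.right_iff _ _ hV]
    rw [h2] at h1
    rw [← h1]
    refine integral_congr_ae (Filter.Eventually.of_forall fun p => ?_)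
    dsimp only
    rw [ds_norm_cn p v V hV hVv]
  rw [integral_congr_ae key]
  simp

theorem ds_main (hν : DsHaar ν) (hσ : DsSph σ) (hψ : Continuous ψ) (hm : Monotone ψ)
    (A : Matrix (Fin (m + 1)) (Fin (m + 1)) ℂ) : dsR σ ψ A ≤ dsP ν ψ A := by
  by_contra hlt
  rw [not_le] at hlt
  let S : Set (Matrix (Unit ⊕ Fin m) (Unit ⊕ Fin m) ℂ) :=
    {M | dsP ν ψ (dsRe m M) < dsR σ ψ (dsRe m M) ∧ dsNorm (dsRe m M) < dsNorm A + 1}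
  have hS : DsSet S := by
    refine ⟨?_, ?_, ?_, ?_, ?_⟩
    · have h1 : IsOpen {M | dsP ν ψ (dsRe m M) < dsR σ ψ (dsRe m M)} := by
        have : {M | dsP ν ψ (dsRe m M) < dsR σ ψ (dsRe m M)} =
            ⋃ k, {M | dsPk ν ψ k (dsRe m M) < dsR σ ψ (dsRe m M)} := by
          ext M
          rw [Set.mem_iUnion]
          constructor
          · intro h
            exact ((dsPk_tendsto hν hψ hm (dsRe m M)).eventually_lt_const h).exists
          · rintro ⟨k, hk⟩
            exact (dsP_le_Pk hν hψ hm k _).trans_lt hk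
        rw [this]
        exact isOpen_iUnion (fun k => isOpen_lt ((dsPk_cont hν hψ hm k).comp dsRe_cont)
          ((dsR_cont hσ hψ hm).comp dsRe_cont))
      exact h1.inter (isOpen_lt (dsNorm_cont.comp dsRe_cont) continuous_const)
    · refine ⟨(dsRe m).symm A, ?_, ?_⟩ <;> rw [AlgEquiv.apply_symm_apply]
      · exact hlt
      · linarith
    · refine ⟨dsNorm A + 1, fun M hM i j => ?_⟩
      have h := dsNorm_entry (dsRe m M) (dsIdx m i) (dsIdx m j)
      rw [dsRe_apply, Equiv.symm_apply_apply, Equiv.symm_apply_apply] at h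
      exact h.trans hM.2.le
    · rintro U M hU ⟨h1, h2⟩
      have hU' := dsRe_unitary U hU
      refine ⟨?_, ?_⟩
      · rw [map_mul, dsP_left hν hψ hm _ _ hU', dsR_left _ _ hU']; exact h1
      · rw [map_mul, dsNorm_unitary_mul _ _ hU']; exact h2
    · rintro U M hU ⟨h1, h2⟩
      have hU' := dsRe_unitary U hU
      refine ⟨?_, ?_⟩
      · rw [map_mul, dsP_right hν hψ _ _ hU', dsR_right hσ hψ _ _ hU']; exact h1
      · rw [map_mul, dsNorm_mul_unitary _ _ hU']; exact h2
  obtain ⟨i1, e1⟩ := hS.fubiniP hν hψ hm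
  obtain ⟨i2, e2⟩ := hS.fubiniR hσ hψ hm
  have hcore := hS.core ψ hψ hm
  rw [← e1, ← e2] at hcore
  have hpos : 0 < ∫ p in dsSE S, (dsR σ ψ (dsX p) - dsP ν ψ (dsX p)) := by
    have hp : ∀ p ∈ dsSE S, 0 < dsR σ ψ (dsX p) - dsP ν ψ (dsX p) := fun p hp => sub_pos.2 hp.1
    rw [setIntegral_pos_iff_support_of_nonneg_ae]
    · refine lt_of_lt_of_le (pos_iff_ne_zero.2 hS.vol_SE_ne_zero) (measure_mono fun p hp' => ?_)
      exact ⟨(hp p hp').ne', hp'⟩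
    · filter_upwards [ae_restrict_mem hS.open_SE.measurableSet] with p hp'
      exact (hp p hp').le
    · exact i2.sub i1
  rw [integral_sub i2 i1] at hpos
  linarith

end Final

theorem ds_final (m : ℕ)
    (A : Matrix (Fin (m + 1)) (Fin (m + 1)) ℂ) (hA : IsUnit A)
    (ν : Measure (Matrix (Fin (m + 1)) (Fin (m + 1)) ℂ)) (hν : DsHaar ν)
    (σ : Measure (EuclideanSpace ℂ (Fin (m + 1)))) (hσ : DsSph σ) :
    ∫ v, Real.log ‖Matrix.toEuclideanLin A v‖ ∂σ ≤ ∫ U, Real.log (dsSr (U * A)) ∂ν := by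
  obtain ⟨B, hB⟩ : ∃ B : Matrix (Fin (m + 1)) (Fin (m + 1)) ℂ, B * A = 1 := by
    obtain ⟨u, rfl⟩ := hA
    exact ⟨_, u.inv_mul⟩
  -- a lower bound for the norms
  obtain ⟨c1, hc1, h1⟩ : ∃ c > 0, ∀ v : EuclideanSpace ℂ (Fin (m + 1)), ‖v‖ = 1 →
      c ≤ ‖Matrix.toEuclideanLin A v‖ := by
    let L := LinearMap.toContinuousLinearMap (Matrix.toEuclideanLin B)
    have hle : ∀ v : EuclideanSpace ℂ (Fin (m + 1)), ‖v‖ = 1 →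
        1 ≤ (‖L‖ + 1) * ‖Matrix.toEuclideanLin A v‖ := by
      intro v hv
      have h := L.le_opNorm (Matrix.toEuclideanLin A v)
      have h2 : L (Matrix.toEuclideanLin A v) = v := by
        change Matrix.toEuclideanLin B (Matrix.toEuclideanLin A v) = v
        rw [← ds_lin_mul, hB]; simp
      rw [h2, hv] at h
      have := norm_nonneg (Matrix.toEuclideanLin A v)
      linarith
    have hL : 0 < ‖L‖ + 1 := by positivity
    refine ⟨(‖L‖ + 1)⁻¹, by positivity, fun v hv => ?_⟩
    rw [inv_le_iff_one_le_mul₀' hL]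
    exact hle v hv
  -- a lower bound for the spectral radii: the product of the roots has fixed modulus
  obtain ⟨c2, hc2, h2⟩ : ∃ c > 0, ∀ U : Matrix (Fin (m + 1)) (Fin (m + 1)) ℂ, star U * U = 1 →
      c ≤ dsSr (U * A) := by
    have hd : 0 < ‖A.det‖ := norm_pos_iff.2 (by
      intro h0
      have := congrArg Matrix.det hB
      rw [Matrix.det_mul, h0, mul_zero, Matrix.det_one] at this
      exact zero_ne_one this)
    refine ⟨min 1 ‖A.det‖, lt_min one_pos hd, fun U hU => ?_⟩
    by_contra hlt
    rw [not_le] at hlt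
    have hU1 : ‖U.det‖ = 1 := by
      have := congrArg Matrix.det hU
      rw [Matrix.det_mul, Matrix.det_one, Matrix.star_eq_conjTranspose,
        Matrix.det_conjTranspose] at this
      have h3 := congrArg norm this
      rw [norm_mul, norm_star, norm_one] at h3
      nlinarith [norm_nonneg U.det]
    have hdet := Matrix.det_eq_prod_roots_charpoly (U * A)
    have hn := congrArg norm hdet
    rw [Matrix.det_mul, norm_mul, hU1, one_mul] at hn
    have hcard : (U * A).charpoly.roots.card = m + 1 := by
      rw [IsAlgClosed.card_roots_eq_natDegree, Matrix.charpoly_natDegree_eq_dim, Fintype.card_fin]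
    have hsr1 : dsSr (U * A) < 1 := hlt.trans_le (min_le_left _ _)
    have hprod : ‖(U * A).charpoly.roots.prod‖ ≤ dsSr (U * A) ^ (m + 1) := by
      have gen : ∀ s : Multiset ℂ, (∀ z ∈ s, ‖z‖ ≤ dsSr (U * A)) →
          ‖s.prod‖ ≤ dsSr (U * A) ^ s.card := by
        intro s
        induction s using Multiset.induction_on with
        | empty => intro _; simp
        | cons a s ih =>
          intro h
          rw [Multiset.prod_cons, norm_mul, Multiset.card_cons, pow_succ, mul_comm]
          exact mul_le_mul (ih fun z hz => h z (Multiset.mem_cons_of_mem hz))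
            (h a (Multiset.mem_cons_self a s)) (norm_nonneg _) (pow_nonneg (dsSr_nonneg _) _)
      have hg := gen (U * A).charpoly.roots (fun z hz => dsSr_ge _ _ (Polynomial.isRoot_of_mem_roots hz))
      rw [hcard] at hg
      exact hg
    have hle : dsSr (U * A) ^ (m + 1) ≤ dsSr (U * A) :=
      pow_le_of_le_one (dsSr_nonneg _) hsr1.le (Nat.succ_ne_zero m)
    have := hlt.trans_le (min_le_right _ _)
    linarith
  let c := min c1 c2
  have hc : 0 < c := lt_min hc1 hc2
  let ψ : ℝ → ℝ := fun t => Real.log (max t c)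
  have hψ : Continuous ψ := by
    refine Continuous.log (by fun_prop) (fun t => (lt_of_lt_of_le hc (le_max_right _ _)).ne')
  have hm : Monotone ψ := fun a b hab =>
    Real.log_le_log (lt_of_lt_of_le hc (le_max_right _ _)) (max_le_max_right c hab)
  have h := ds_main hν hσ hψ hm A
  have ea : dsR σ ψ A = ∫ v, Real.log ‖Matrix.toEuclideanLin A v‖ ∂σ := by
    refine integral_congr_ae ?_
    filter_upwards [hσ.supp] with v hv
    simp only [ψ]
    rw [max_eq_left ((min_le_left _ _).trans (h1 v hv))]
  have eb : dsP ν ψ A = ∫ U, Real.log (dsSr (U * A)) ∂ν := by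
    refine integral_congr_ae ?_
    filter_upwards [hν.supp] with U hU
    simp only [ψ]
    rw [max_eq_left ((min_le_right _ _).trans (h2 U hU))]
  rwa [ea, eb] at h

/-- (Dedieu–Shub) Let `n ≥ 2`, let `A` be an invertible `n×n` complex matrix, let `ν` be the
Haar probability measure on the unitary group `U(n)` (characterized as the unique Borel
probability measure supported on the unitaries and invariant under left translation by
unitaries), and let `σ` be the unitarily invariant probability measure on the unit sphere of
`ℂⁿ`.  Then `∫_{U(n)} log ρ(U·A) dν(U) ≥ ∫ log ‖A·v‖ dσ(v)`. -/
theorem dedieu_shub_unitary_coset (n : ℕ) (hn : 2 ≤ n)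
    (A : Matrix (Fin n) (Fin n) ℂ) (hA : IsUnit A)
    (ν : Measure (Matrix (Fin n) (Fin n) ℂ)) [IsProbabilityMeasure ν]
    (hνsupp : ν {U | star U * U = 1}ᶜ = 0)
    (hνinv : ∀ V : Matrix (Fin n) (Fin n) ℂ, star V * V = 1 →
      Measure.map (fun U => V * U) ν = ν)
    (σ : Measure (EuclideanSpace ℂ (Fin n))) [IsProbabilityMeasure σ]
    (hσsphere : σ (Metric.sphere (0 : EuclideanSpace ℂ (Fin n)) 1)ᶜ = 0)
    (hσinv : ∀ U : Matrix (Fin n) (Fin n) ℂ, star U * U = 1 →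
      Measure.map (fun v => Matrix.toEuclideanLin U v) σ = σ) :
    ∫ U, Real.log (specRadC (U * A)) ∂ν ≥
      ∫ v, Real.log ‖Matrix.toEuclideanLin A v‖ ∂σ := by
  obtain ⟨m, rfl⟩ : ∃ m, n = m + 1 := ⟨n - 1, by omega⟩
  refine ds_final m A hA ν ⟨inferInstance, ?_, hνinv⟩ σ ⟨inferInstance, ?_, hσinv⟩
  · exact hνsupp
  · have h : ∀ᵐ v ∂σ, v ∈ Metric.sphere (0 : EuclideanSpace ℂ (Fin (m + 1))) 1 := hσsphere
    filter_upwards [h] with v hv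
    simpa using hv
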